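/- Every monic irreducible cubic polynomial in F_{q^2}[x] satisfying Condition (1) is equivalent to P_{δ,1}(x) = x^3 − δx^2 − (δ+3)x − 1 for some δ ∈ F_{q^2}. Furthermore, the number of equivalence classes of monic irreducible cubic polynomials in F_{q^2}[x] satisfying Condition (1) is (q−1)/3 if q ≡ 1 (mod 3) and (q+1)/3 if q ≡ 2 (mod 3). -/

import Mathlib

noncomputable section

open Polynomial

/-- A polynomial `P` over `F = 𝔽_{q²}`, of degree `m`, satisfies Condition (1). -/
def Condition1 {F : Type*} [Field F] (q m : ℕ) (P : Polynomial F) : Prop :=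
  ∀ x y : F, x ≠ 0 → y ≠ 0 →
    (x ^ m * P.eval (x ^ (q - 1))) * (y ^ m * P.eval (y ^ (q - 1))) ^ q =
      (x ^ m * P.eval (x ^ (q - 1))) ^ q * (y ^ m * P.eval (y ^ (q - 1))) →
    x * y ^ q = x ^ q * y

/-- `P` is a monic irreducible cubic over `𝔽_{q²}` satisfying Condition (1). -/
def Good {F : Type*} [Field F] (q : ℕ) (P : Polynomial F) : Prop :=
  P.Monic ∧ P.natDegree = 3 ∧ Irreducible P ∧ Condition1 q 3 P

/-- For a cubic `P`, the polynomial `(u + v^q x)³ · P((v + u^q x)/(u + v^q x))`. -/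
def moebius3 {F : Type*} [Field F] (q : ℕ) (u v : F) (P : Polynomial F) : Polynomial F :=
  ∑ i ∈ Finset.range 4,
    C (P.coeff i) * (C v + C (u ^ q) * X) ^ i * (C u + C (v ^ q) * X) ^ (3 - i)

/-- Equivalence of cubics `P, Q`: `Q(x) = λ(u + v^q x)³ P^σ((v + u^q x)/(u + v^q x))`
for some `λ ≠ 0`, `u^{q+1} ≠ v^{q+1}`, and `σ ∈ {id, q-th power Frobenius}` applied to the
coefficients of `P`. -/
def PolEquiv {F : Type*} [Field F] (q : ℕ) (P Q : Polynomial F) : Prop :=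
  ∃ lam u v : F, lam ≠ 0 ∧ u ^ (q + 1) ≠ v ^ (q + 1) ∧
    (Q = C lam * moebius3 q u v P ∨
      Q = C lam * moebius3 q u v (∑ i ∈ Finset.range (P.natDegree + 1),
        C ((P.coeff i) ^ q) * X ^ i))

theorem natDegree_eq_of_derivative_mul_eq {F : Type*} [Field F] (h2 : (2 : F) ≠ 0)
    (h3 : (3 : F) ≠ 0) {A B : F[X]} (hA : A ≠ 0) (hB : B ≠ 0) (hA4 : A.natDegree ≤ 4)
    (hB4 : B.natDegree ≤ 4) (h : derivative A * B = A * derivative B) :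
    A.natDegree = B.natDegree := by
  have lead : ∀ P : F[X], (X * derivative P).coeff P.natDegree = P.natDegree * P.leadingCoeff := by
    intro P
    rcases Nat.eq_zero_or_pos P.natDegree with h0 | h0
    · simp [h0]
    · obtain ⟨d, hd⟩ := Nat.exists_eq_succ_of_ne_zero h0.ne'
      rw [leadingCoeff, hd, coeff_X_mul, coeff_derivative]
      push_cast; ring
  have deg : ∀ P : F[X], (X * derivative P).natDegree ≤ P.natDegree := by
    intro P
    rcases Nat.eq_zero_or_pos P.natDegree with h0 | h0
    · rw [natDegree_eq_zero] at h0
      obtain ⟨c, rfl⟩ := h0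
      simp
    · refine (natDegree_mul_le).trans ?_
      have := natDegree_derivative_le P
      rw [natDegree_X]; omega
  have h' : (X * derivative A) * B = A * (X * derivative B) := by
    linear_combination X * h
  have e1 := coeff_mul_add_eq_of_natDegree_le (deg A) (le_refl B.natDegree)
  have e2 := coeff_mul_add_eq_of_natDegree_le (le_refl A.natDegree) (deg B)
  rw [h', e2, lead, lead] at e1
  have hz : ((B.natDegree : F) - A.natDegree) = 0 := by
    have : ((B.natDegree : F) - A.natDegree) * (A.leadingCoeff * B.leadingCoeff) = 0 := by
      simp only [leadingCoeff] at e1 ⊢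
      linear_combination e1
    rcases mul_eq_zero.1 this with h | h
    · exact h
    · rcases mul_eq_zero.1 h with h | h <;> simp_all
  generalize A.natDegree = a at *
  generalize B.natDegree = b at *
  have h4 : (4 : F) ≠ 0 := by
    have : (4 : F) = 2 * 2 := by norm_num
    rw [this]; exact mul_ne_zero h2 h2
  interval_cases a <;> interval_cases b <;> first | rfl | (exfalso; norm_num at hz) <;>
    first | exact h2 (by linear_combination hz) | exact h3 (by linear_combination hz) |
      exact h4 (by linear_combination hz)

theorem exists_eq_C_mul_sq {F : Type*} [Field F] (h2 : (2 : F) ≠ 0)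
    (h3 : (3 : F) ≠ 0) {D k : F[X]} (hD : D.natDegree ≤ 4) (hk : k.natDegree ≤ 2) (hk0 : k ≠ 0)
    (h : 2 * D * derivative k = derivative D * k) : ∃ c, D = C c * k ^ 2 := by
  have hkk : k ^ 2 ≠ 0 := pow_ne_zero _ hk0
  have hkd : (k ^ 2).natDegree ≤ 4 := by rw [natDegree_pow]; omega
  by_cases hD0 : D = 0
  · exact ⟨0, by simp [hD0]⟩
  have key : ∀ E : F[X], 2 * E * derivative k = derivative E * k →
      derivative E * k ^ 2 = E * derivative (k ^ 2) := by
    intro E hE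
    rw [pow_two, derivative_mul]; linear_combination -k * hE
  have hdeg := natDegree_eq_of_derivative_mul_eq h2 h3 hD0 hkk hD hkd (key D h)
  refine ⟨D.leadingCoeff / (k ^ 2).leadingCoeff, ?_⟩
  set c := D.leadingCoeff / (k ^ 2).leadingCoeff
  have hc : c * (k ^ 2).leadingCoeff = D.leadingCoeff :=
    div_mul_cancel₀ _ (leadingCoeff_ne_zero.2 hkk)
  by_contra hne
  have hE0 : D - C c * k ^ 2 ≠ 0 := sub_ne_zero.2 hne
  have hle : (D - C c * k ^ 2).natDegree ≤ (k ^ 2).natDegree :=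
    (natDegree_sub_le _ _).trans (max_le hdeg.le (natDegree_C_mul_le _ _))
  have := natDegree_eq_of_derivative_mul_eq h2 h3 hE0 hkk (hle.trans hkd) hkd (key _ (by
    simp only [derivative_sub, pow_two, derivative_mul, derivative_C]
    linear_combination h))
  have h0 : (D - C c * k ^ 2).coeff (k ^ 2).natDegree = 0 := by
    rw [coeff_sub, coeff_C_mul, ← leadingCoeff, hc, ← hdeg, ← leadingCoeff, sub_self]
  rw [← this, ← leadingCoeff, leadingCoeff_eq_zero] at h0
  exact hE0 h0

theorem exists_quartic_coeffs {F : Type*} [Field F] {D : F[X]} (hD : D.natDegree ≤ 4) :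
    ∃ d0 d1 d2 d3 d4 : F, D = C d0 + C d1 * X + C d2 * X ^ 2 + C d3 * X ^ 3 + C d4 * X ^ 4 := by
  refine ⟨D.coeff 0, D.coeff 1, D.coeff 2, D.coeff 3, D.coeff 4, ?_⟩
  conv_lhs => rw [D.as_sum_range_C_mul_X_pow' (show D.natDegree < 5 by omega)]
  simp [Finset.sum_range_succ]

/-- The covariant of a quartic occurring in Stepanov's method has degree at most six, and a quartic
on which it vanishes is a constant multiple of a square. -/
theorem quartic_covariant {F : Type*} [Field F] (h2 : (2 : F) ≠ 0)
    (h3 : (3 : F) ≠ 0) {D : F[X]} (hD : D.natDegree ≤ 4) {S : F[X]}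
    (hS : S = 4 * X * D * derivative D - 2 * X ^ 2 * D * derivative (derivative D) - 8 * D ^ 2
      + X ^ 2 * derivative D ^ 2) :
    S.natDegree ≤ 6 ∧ (S = 0 → ∃ c κ, κ.natDegree ≤ 2 ∧ D = C c * κ ^ 2) := by
  obtain ⟨d0, d1, d2, d3, d4, rfl⟩ := exists_quartic_coeffs hD
  have hS' : S = C (-8 * d0 ^ 2) + C (-12 * d0 * d1) * X + C (-12 * d0 * d2 - 3 * d1 ^ 2) * X ^ 2
      + C (-16 * d0 * d3 - 4 * d1 * d2) * X ^ 3 + C (-24 * d0 * d4 - 6 * d1 * d3) * X ^ 4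
      + C (-12 * d1 * d4) * X ^ 5 + C (-4 * d2 * d4 + d3 ^ 2) * X ^ 6 := by
    rw [hS]
    simp only [derivative_add, derivative_mul, derivative_C, derivative_X, derivative_X_pow,
      derivative_zero, derivative_one, C_add, C_sub, C_mul, C_neg, C_pow,
      map_ofNat]
    push_cast
    simp only [map_ofNat, C_1]
    ring
  constructor
  · rw [hS']; compute_degree
  · intro h0
    rw [h0] at hS'
    have c0 := congrArg (fun P => P.coeff 0) hS'
    have c2 := congrArg (fun P => P.coeff 2) hS'
    have c6 := congrArg (fun P => P.coeff 6) hS'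
    simp [coeff_X, coeff_X_pow, coeff_C, -map_mul, -map_neg, -map_sub, -map_add] at c0 c2 c6
    have h8 : (8 : F) ≠ 0 := by
      have : (8 : F) = 2 ^ 3 := by norm_num
      rw [this]; exact pow_ne_zero _ h2
    obtain rfl : d0 = 0 := c0.resolve_left h8
    obtain rfl : d1 = 0 := by simpa [h3] using c2
    by_cases h4 : d4 = 0
    · subst h4
      obtain rfl : d3 = 0 := by simpa using c6.symm
      exact ⟨d2, X, by simp, by simp⟩
    · refine ⟨d4, X * (X + C (d3 / (2 * d4))), by compute_degree, ?_⟩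
      have e2 : d2 = d4 * (d3 / (2 * d4)) ^ 2 := by field_simp; linear_combination c6
      have e3 : d3 = 2 * d4 * (d3 / (2 * d4)) := by field_simp
      generalize d3 / (2 * d4) = t at *
      subst e2; subst e3
      simp only [C_mul, C_pow, map_ofNat, C_0]
      ring

theorem stepanov_quartic {F : Type*} [Field F] (h2 : (2 : F) ≠ 0) (h3 : (3 : F) ≠ 0) {q m : ℕ}
    (hqm : q = 2 * m + 1) (hq5 : 5 ≤ q) (hq0 : (q : F) = 0) {D h : F[X]} (hD : D.natDegree ≤ 4)
    (hE : X ^ 2 * D ^ m - 1 = (X ^ (q + 1) - 1) * h) :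
    ∃ c κ, κ.natDegree ≤ 2 ∧ D = C c * κ ^ 2 := by
  have hmon : (X ^ (q + 1) - 1 : F[X]).Monic := monic_X_pow_sub_C (1 : F) (by omega)
  have hdegM : (X ^ (q + 1) - 1 : F[X]).natDegree = q + 1 := natDegree_X_pow_sub_C (r := (1 : F))
  have hmul : ∀ f : F[X], f ≠ 0 → ((X ^ (q + 1) - 1) * f).natDegree = q + 1 + f.natDegree := by
    intro f hf
    rw [hmon.natDegree_mul' hf, hdegM]
  have hhdeg : h.natDegree ≤ q - 1 := by
    by_cases hh : h = 0
    · simp [hh]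
    have h1 := hmul h hh
    rw [← hE] at h1
    have h2 : (X ^ 2 * D ^ m - 1 : F[X]).natDegree ≤ 2 + m * 4 := by
      refine (natDegree_sub_le _ _).trans (max_le ?_ (by simp))
      refine natDegree_mul_le.trans ?_
      rw [natDegree_X_pow]
      have := natDegree_pow_le_of_le m hD
      omega
    omega
  obtain ⟨l, hl⟩ : ∃ l, m = l + 1 := ⟨m - 1, by omega⟩
  have hq0' : (q : F[X]) = 0 := by
    rw [← C_eq_natCast, hq0, C_0]
  have hm : 2 * (m : F[X]) + 1 = 0 := by
    rw [← hq0', hqm]; push_cast; ring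
  have dE := congrArg derivative hE
  simp only [derivative_sub, derivative_mul, derivative_X, derivative_pow, derivative_one,
    C_eq_natCast] at dE
  have hY : X * (((q + 1 : ℕ) : F[X]) * X ^ (q + 1 - 1)) = (X ^ (q + 1) : F[X]) := by
    rw [Nat.cast_add, hq0', Nat.add_sub_cancel]; push_cast; ring
  have dY : derivative (X ^ (q + 1) : F[X]) = ((q + 1 : ℕ) : F[X]) * X ^ (q + 1 - 1) := by
    rw [derivative_X_pow, C_eq_natCast]
  have hDm : D ^ m = D ^ (m - 1) * D := by rw [hl]; simp [pow_succ]
  rw [hDm] at dE hE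
  simp only [show (2 - 1 : ℕ) = 1 from rfl, Nat.cast_ofNat] at dE
  generalize hYd : (((q + 1 : ℕ) : F[X]) * X ^ (q + 1 - 1)) = Y' at *
  generalize (D ^ (m - 1)) = G at *
  generalize hYY : (X ^ (q + 1) : F[X]) = Y at *
  set k := 2 * D * X * derivative h - 2 * D * h + X * derivative D * h with hk
  have e2 : (Y - 1) * k = 4 * D - X * derivative D - 2 * D * h := by
    linear_combination (-2 * X * D) * dE + (4 * D - X * derivative D) * hE
      + X ^ 3 * G * D * derivative D * hm - 2 * D * h * hY
  have d2 := congrArg derivative e2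
  simp only [derivative_sub, derivative_mul, derivative_one, dY, derivative_X,
    derivative_ofNat] at d2
  have e3 : (Y - 1) * (X * (2 * D * derivative k - derivative D * k)) =
      (4 * X * D * derivative D - 2 * X ^ 2 * D * derivative (derivative D) - 8 * D ^ 2
      + X ^ 2 * derivative D ^ 2) - 4 * D * k := by
    linear_combination 2 * D * X * d2 - 2 * D * k * hY - (2 * D + X * derivative D) * e2
      + 2 * D * hk
  have hkdeg : k.natDegree ≤ 2 := by
    by_cases hk0 : k = 0
    · simp [hk0]
    have h1 := hmul k hk0
    rw [e2] at h1
    have h4 : (4 * D - X * derivative D - 2 * D * h : F[X]).natDegree ≤ q + 3 := by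
      have hd' : (derivative D).natDegree ≤ 3 := (natDegree_derivative_le D).trans (by omega)
      compute_degree
      omega
    omega
  obtain ⟨hS6, hSsq⟩ := quartic_covariant h2 h3 hD rfl
  by_cases hk0 : k = 0
  · apply hSsq
    rw [hk0] at e3
    simpa using e3.symm
  have hz : X * (2 * D * derivative k - derivative D * k) = 0 := by
    by_contra hne
    have h1 := hmul _ hne
    rw [e3, natDegree_X_mul (right_ne_zero_of_mul hne)] at h1
    have h4 : (4 * D * k : F[X]).natDegree ≤ 6 := by compute_degree; omega
    have := natDegree_sub_le_of_le hS6 h4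
    simp only [max_self] at this
    omega
  obtain ⟨c, hc⟩ := exists_eq_C_mul_sq h2 h3 hD hkdeg hk0
    (sub_eq_zero.1 ((mul_eq_zero.1 hz).resolve_left X_ne_zero))
  exact ⟨c, k, hkdeg, hc⟩

/-- `F` is a finite field with `q ^ 2` elements, of characteristic at least five, and `σ` is the
`q`-th power Frobenius. -/
structure QuadExt (F : Type*) [Field F] [Fintype F] (q : ℕ) (σ : F →+* F) : Prop where
  pow : ∀ x, σ x = x ^ q
  invol : ∀ x, σ (σ x) = x
  card : Fintype.card F = q ^ 2
  odd : Odd q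
  five_le : 5 ≤ q
  two_ne : (2 : F) ≠ 0
  three_ne : (3 : F) ≠ 0
  cast_eq : (q : F) = 0

namespace QuadExt

variable {F : Type*} [Field F] [Fintype F] {q : ℕ} {σ : F →+* F}

theorem pow_succ_eq (S : QuadExt F q σ) (x : F) : x ^ (q + 1) = x * σ x := by
  rw [S.pow, pow_succ, mul_comm]

theorem map_eq_inv {F : Type*} [Field F] {σ : F →+* F} {z : F} (hz : z * σ z = 1) : σ z = z⁻¹ :=
  eq_inv_of_mul_eq_one_right hz

theorem ne_zero_of_unit {F : Type*} [Field F] {σ : F →+* F} {z : F} (hz : z * σ z = 1) : z ≠ 0 :=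
  left_ne_zero_of_mul_eq_one hz

theorem sq_sub_one (S : QuadExt F q σ) : q ^ 2 - 1 = (q - 1) * (q + 1) := by
  obtain ⟨r, rfl⟩ : ∃ r, q = r + 1 := ⟨q - 1, by have := S.five_le; omega⟩
  rw [Nat.add_sub_cancel]
  have : (r + 1) ^ 2 = r * (r + 1 + 1) + 1 := by ring
  omega

theorem exists_primitiveRoot (S : QuadExt F q σ) : ∃ γ : F, IsPrimitiveRoot γ (q ^ 2 - 1) := by
  obtain ⟨g, hg⟩ := IsCyclic.exists_generator (α := Fˣ)
  refine ⟨(g : F), ?_⟩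
  rw [IsPrimitiveRoot.coe_units_iff]
  have : orderOf g = q ^ 2 - 1 := by
    rw [orderOf_eq_card_of_forall_mem_zpowers hg, Nat.card_units, Nat.card_eq_fintype_card, S.card]
  rw [← this]
  exact IsPrimitiveRoot.orderOf g

theorem exists_primitiveRoot_succ (S : QuadExt F q σ) : ∃ ζ : F, IsPrimitiveRoot ζ (q + 1) := by
  obtain ⟨γ, hγ⟩ := S.exists_primitiveRoot
  refine ⟨γ ^ (q - 1), hγ.pow ?_ S.sq_sub_one⟩
  have := S.five_le
  have : 5 ^ 2 ≤ q ^ 2 := Nat.pow_le_pow_left this 2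
  omega

theorem exists_map_ne (S : QuadExt F q σ) : ∃ t, σ t ≠ t := by
  obtain ⟨γ, hγ⟩ := S.exists_primitiveRoot
  refine ⟨γ, fun h => ?_⟩
  have h5 := S.five_le
  have h25 : 5 * q ≤ q ^ 2 := by rw [pow_two]; exact Nat.mul_le_mul_right q h5
  rw [S.pow] at h
  have h0 : γ ≠ 0 := hγ.ne_zero (by omega)
  have : γ ^ (q - 1) = 1 := by
    apply mul_right_cancel₀ h0
    rw [← pow_succ, one_mul, Nat.sub_add_cancel (by omega), h]
  have := Nat.le_of_dvd (by omega) (hγ.dvd_of_pow_eq_one _ this)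
  omega

/-- Hilbert's Theorem 90. -/
theorem exists_map_eq_mul (S : QuadExt F q σ) {c : F} (hc : c * σ c = 1) :
    ∃ s, s ≠ 0 ∧ σ s = c * s := by
  have key : ∀ t, σ (t + σ c * σ t) = c * (t + σ c * σ t) := by
    intro t
    rw [map_add, map_mul, S.invol, S.invol]
    linear_combination -σ t * hc
  by_cases h1 : 1 + σ c * σ 1 = 0
  · obtain ⟨t, ht⟩ := S.exists_map_ne
    refine ⟨_, fun h0 => ht ?_, key t⟩
    rw [map_one] at h1
    linear_combination -h0 + σ t * h1
  · exact ⟨_, h1, key 1⟩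

theorem X_pow_sub_one_dvd (S : QuadExt F q σ) {f : F[X]}
    (hf : ∀ z, z * σ z = 1 → f.eval z = 0) : X ^ (q + 1) - 1 ∣ f := by
  obtain ⟨ζ, hζ⟩ := S.exists_primitiveRoot_succ
  rw [X_pow_sub_one_eq_prod (Nat.succ_pos q) hζ]
  refine Finset.prod_dvd_of_coprime ?_ ?_
  · exact (pairwise_coprime_X_sub_C Function.injective_id).set_pairwise _
  · intro z hz
    rw [mem_nthRootsFinset (Nat.succ_pos q), S.pow_succ_eq] at hz
    exact dvd_iff_isRoot.2 (hf z hz)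

theorem natDegree_X_pow_sub_one {F : Type*} [Field F] {q : ℕ} :
    (X ^ (q + 1) - 1 : F[X]).natDegree = q + 1 :=
  natDegree_X_pow_sub_C (r := (1 : F))

theorem exists_unit_eval_ne_zero (S : QuadExt F q σ) {f : F[X]} (hf : f ≠ 0)
    (hdeg : f.natDegree ≤ q) : ∃ z, z * σ z = 1 ∧ f.eval z ≠ 0 := by
  by_contra! h
  have := natDegree_le_of_dvd (S.X_pow_sub_one_dvd h) hf
  rw [natDegree_X_pow_sub_one] at this
  omega

theorem isSquare_of_pow_eq_one (S : QuadExt F q σ) {m : ℕ} (hm : q = 2 * m + 1) {e : F}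
    (he : (e ^ m) ^ (q + 1) = 1) : ∃ s, e = s ^ 2 := by
  have he0 : e ≠ 0 := by
    rintro rfl
    have := S.five_le
    rw [zero_pow (by omega), zero_pow (by omega)] at he
    exact zero_ne_one he
  have hchar : ringChar F ≠ 2 := by
    intro h
    apply S.two_ne
    have := ringChar.Nat.cast_ringChar (R := F)
    rw [h] at this
    exact_mod_cast this
  have hcard : Fintype.card F / 2 = m * (q + 1) := by
    rw [S.card, hm]
    have : (2 * m + 1) ^ 2 = 2 * (m * (2 * m + 1 + 1)) + 1 := by ring
    omega
  obtain ⟨s, hs⟩ := (FiniteField.isSquare_iff hchar he0).2 (by rw [hcard, pow_mul, he])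
  exact ⟨s, by rw [hs, pow_two]⟩

/-- Condition (1) expressed on the unit circle `z * σ z = 1`. -/
theorem condition1_iff (S : QuadExt F q σ) (P : F[X]) :
    Condition1 q 3 P ↔ ∀ z w, z * σ z = 1 → w * σ w = 1 →
      P.eval z * (w ^ 3 * σ (P.eval w)) = z ^ 3 * σ (P.eval z) * P.eval w → z = w := by
  have hq1 : ∀ x : F, x ≠ 0 → x ^ (q - 1) * x = σ x := by
    intro x hx
    rw [← pow_succ, Nat.sub_add_cancel (by have := S.five_le; omega), S.pow]
  constructor
  · intro h z w hz hw heq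
    obtain ⟨x, hx, hxz⟩ := S.exists_map_eq_mul hz
    obtain ⟨y, hy, hyw⟩ := S.exists_map_eq_mul hw
    have hx1 : x ^ (q - 1) = z := mul_right_cancel₀ hx (by rw [hq1 x hx, hxz])
    have hy1 : y ^ (q - 1) = w := mul_right_cancel₀ hy (by rw [hq1 y hy, hyw])
    have := h x y hx hy (by
      rw [hx1, hy1, ← S.pow, ← S.pow]
      simp only [map_mul, map_pow, hxz, hyw]
      linear_combination x ^ 3 * y ^ 3 * heq)
    rw [← S.pow, ← S.pow, hxz, hyw] at this
    apply mul_right_cancel₀ (mul_ne_zero hx hy)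
    linear_combination -this
  · intro h x y hx hy heq
    have hx1 := hq1 x hx
    have hy1 := hq1 y hy
    have hu : ∀ x, x ≠ 0 → x ^ (q - 1) * σ (x ^ (q - 1)) = 1 := by
      intro x hx
      have hx1 := hq1 x hx
      have hx2 := congrArg σ hx1
      rw [map_mul, S.invol] at hx2
      apply mul_right_cancel₀ (mul_ne_zero hx ((map_ne_zero σ).2 hx))
      linear_combination (σ (x ^ (q - 1)) * σ x) * hx1 + σ x * hx2
    rw [← S.pow, ← S.pow] at heq ⊢
    have := h _ _ (hu x hx) (hu y hy) (by
      apply mul_right_cancel₀ (pow_ne_zero 3 (mul_ne_zero hx hy))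
      simp only [map_mul, map_pow, ← hx1, ← hy1] at heq ⊢
      linear_combination heq)
    rw [← hx1, ← hy1, this]; ring

/-- A self-reciprocal quadratic without roots on the unit circle, except possibly `w`, has square
discriminant in the real subfield, or else a double root at `w`. -/
theorem disc_pow_eq_one_or (S : QuadExt F q σ) {m : ℕ} (hm : q = 2 * m + 1) {A B C w : F}
    (hw : w * σ w = 1) (hC : C = w ^ 2 * σ A) (hB : B = w ^ 2 * σ B)
    (H : ∀ z, z * σ z = 1 → A * z ^ 2 + B * z + C = 0 → z = w) :
    w ^ 2 * (B ^ 2 - 4 * A * C) ^ m = 1 ∨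
      (A ≠ 0 ∧ B = -2 * A * w ∧ C = A * w ^ 2) := by
  have hw0 := ne_zero_of_unit hw
  have hσw := map_eq_inv hw
  have h2 := S.two_ne
  have hσA : σ A = C / w ^ 2 := by rw [hC]; field_simp
  have hσB : σ B = B / w ^ 2 := by rw [eq_div_iff (pow_ne_zero 2 hw0)]; linear_combination -hB
  have hσC : σ C = A / w ^ 2 := by rw [hC, map_mul, map_pow, S.invol, hσw]; field_simp
  have hwm : w ^ (2 * m) * w ^ 2 = 1 := by
    rw [← pow_add, show 2 * m + 2 = q + 1 by omega, S.pow_succ_eq, hw]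
  set e := (B ^ 2 - 4 * A * C) / w ^ 2 with he
  have hDe : B ^ 2 - 4 * A * C = w ^ 2 * e := by rw [he]; field_simp
  have hσe : σ e = e := by
    rw [he]
    simp only [map_div₀, map_sub, map_mul, map_pow, map_ofNat, hσA, hσB, hσC, hσw]
    field_simp
  by_cases he0 : e = 0
  · right
    have hD0 : B ^ 2 - 4 * A * C = 0 := by rw [hDe, he0, mul_zero]
    have hA : A ≠ 0 := by
      intro hA
      have hC0 : C = 0 := by rw [hC, hA]; simp
      have hB0 : B = 0 := by rw [hA] at hD0; simpa using hD0
      have h1 := H 1 (by simp) (by rw [hA, hB0, hC0]; ring)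
      have h2' := H (-1) (by simp) (by rw [hA, hB0, hC0]; ring)
      apply h2
      linear_combination h1 - h2'
    have hC0 : C ≠ 0 := by
      intro h
      rw [h, zero_div, map_eq_zero] at hσA
      exact hA hσA
    have hz := H (-B / (2 * A)) (by
      simp only [map_div₀, map_mul, map_neg, map_ofNat, hσA, hσB]
      field_simp
      linear_combination hD0) (by
      field_simp
      linear_combination -hD0)
    have hBw : B = -2 * A * w := by
      rw [← hz]; field_simp
    refine ⟨hA, hBw, ?_⟩
    rw [hBw] at hD0
    have : (2 * 2 * A) * (A * w ^ 2 - C) = 0 := by linear_combination hD0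
    have := (mul_eq_zero.1 this).resolve_left (mul_ne_zero (mul_ne_zero h2 h2) hA)
    linear_combination -this
  · left
    have heq : (e ^ m) ^ 2 = 1 := by
      apply mul_right_cancel₀ he0
      rw [← pow_mul, ← pow_succ, show m * 2 + 1 = q by omega, ← S.pow, hσe, one_mul]
    rcases mul_self_eq_one_iff.1 ((pow_two _).symm.trans heq) with h1 | h1
    · rw [hDe, mul_pow, h1, ← pow_mul]
      linear_combination hwm
    · exfalso
      obtain ⟨s, hs⟩ := S.isSquare_of_pow_eq_one hm (e := e) (by
        rw [h1, hm]
        have : 2 * m + 1 + 1 = 2 * (m + 1) := by ring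
        rw [this, pow_mul]; simp)
      have hs0 : s ≠ 0 := by rintro rfl; exact he0 (by rw [hs]; ring)
      have hσs : σ s = -s := by
        rw [S.pow, hm, pow_succ, pow_mul, ← hs, h1]; ring
      have hA : A ≠ 0 := by
        intro hA
        have hC0 : C = 0 := by rw [hC, hA]; simp
        have : s ^ 2 = (B / w) ^ 2 := by
          rw [← hs, he, hA]; field_simp; ring
        have hσ : σ (B / w) = B / w := by
          rw [map_div₀, hσB, hσw]; field_simp
        rcases sq_eq_sq_iff_eq_or_eq_neg.1 this with h | h
        · rw [← h, hσs] at hσ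
          exact mul_ne_zero h2 hs0 (by linear_combination -hσ)
        · have h' : B / w = -s := by rw [h]; ring
          rw [h', map_neg, hσs] at hσ
          exact mul_ne_zero h2 hs0 (by linear_combination hσ)
      have hC0 : C ≠ 0 := by
        intro h
        rw [h, zero_div, map_eq_zero] at hσA
        exact hA hσA
      have hsD : w ^ 2 * s ^ 2 = B ^ 2 - 4 * A * C := by rw [hDe, hs]
      have root : ∀ t, t ^ 2 = s ^ 2 → σ t = -t → (-B + w * t) / (2 * A) = w := by
        intro t ht hσt
        apply H
        · simp only [map_div₀, map_mul, map_neg, map_add, map_ofNat, hσA, hσB, hσt, hσw]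
          field_simp
          linear_combination -w ^ 2 * ht - hsD
        · field_simp
          linear_combination w ^ 2 * ht + hsD
      have r1 := root s rfl hσs
      have r2 := root (-s) (by ring) (by rw [map_neg, hσs])
      have r3 := (div_left_inj' (mul_ne_zero h2 hA)).1 (r1.trans r2.symm)
      have : 2 * (w * s) = 0 := by linear_combination r3
      exact mul_ne_zero h2 (mul_ne_zero hw0 hs0) this

end QuadExt

/-- The discriminant of the Bezoutian quotient
`a + b (z + w) + c (z² + z w + w²) + d z w + e z w (z + w) + f z² w²`, with respect to `z`. -/
def bezoutDisc {F : Type*} [Field F] (a b c d e f : F) : F[X] :=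
  (C b + C (c + d) * X + C e * X ^ 2) ^ 2
    - 4 * (C c + C e * X + C f * X ^ 2) * (C a + C b * X + C c * X ^ 2)

namespace QuadExt

variable {F : Type*} [Field F] [Fintype F] {q : ℕ} {σ : F →+* F}

/-- If the discriminant takes a nonzero square value on the unit circle, the constant factor can be
absorbed into the square. -/
theorem exists_eq_sq_of_eq_C_mul_sq (S : QuadExt F q σ) {m : ℕ} (hm : q = 2 * m + 1) {D κ : F[X]}
    {c w : F} (hκ : κ.natDegree ≤ 2) (hD : D = C c * κ ^ 2) (hw : w * σ w = 1)
    (h : w ^ 2 * (D.eval w) ^ m = 1) : ∃ κ : F[X], κ.natDegree ≤ 2 ∧ D = κ ^ 2 := by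
  obtain ⟨s, hs⟩ := S.isSquare_of_pow_eq_one hm (e := D.eval w) (by
    have h1 : (w ^ 2 * (D.eval w) ^ m) ^ (q + 1) = 1 := by rw [h, one_pow]
    rw [mul_pow, ← pow_mul, mul_comm 2, pow_mul, S.pow_succ_eq w, hw] at h1
    simpa using h1)
  have hw0 : κ.eval w ≠ 0 := by
    intro h0
    rw [hD, eval_mul, eval_pow, h0, zero_pow two_ne_zero, mul_zero,
      zero_pow (by have := S.five_le; omega), mul_zero] at h
    exact zero_ne_one h
  refine ⟨C (s / κ.eval w) * κ, (natDegree_C_mul_le _ _).trans hκ, ?_⟩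
  have hc : c = (s / κ.eval w) ^ 2 := by
    rw [hD, eval_mul, eval_C, eval_pow] at hs
    field_simp
    exact hs
  rw [hD, hc, C_pow]; ring

theorem bezoutDisc_isSquare (S : QuadExt F q σ) {a b c d e f : F} (ha : σ a = f) (hb : σ b = e)
    (hc : σ c = c) (hd : σ d = d) (pl : a * f - b * e + c * d = 0)
    (H : ∀ z w, z * σ z = 1 → w * σ w = 1 →
      a + b * (z + w) + c * (z ^ 2 + z * w + w ^ 2) + d * (z * w) + e * (z * w * (z + w))
        + f * (z ^ 2 * w ^ 2) = 0 → z = w) :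
    ∃ κ : F[X], κ.natDegree ≤ 2 ∧ bezoutDisc a b c d e f = κ ^ 2 := by
  obtain ⟨m, hm⟩ := S.odd
  have hq5 := S.five_le
  have h2 := S.two_ne
  have h3 := S.three_ne
  set D := bezoutDisc a b c d e f with hDdef
  have hσf : σ f = a := by rw [← ha, S.invol]
  have hσe : σ e = b := by rw [← hb, S.invol]
  have hdeg : D.natDegree ≤ 4 := by
    rw [hDdef, bezoutDisc]; compute_degree
  have hDw : ∀ w, D.eval w = (b + (c + d) * w + e * w ^ 2) ^ 2
      - 4 * (c + e * w + f * w ^ 2) * (a + b * w + c * w ^ 2) := by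
    intro w; simp [hDdef, bezoutDisc]
  have pt : ∀ w, w * σ w = 1 → w ^ 2 * (D.eval w) ^ m = 1 ∨ (c + e * w + f * w ^ 2 ≠ 0 ∧
      b + (c + d) * w + e * w ^ 2 = -2 * (c + e * w + f * w ^ 2) * w ∧
      a + b * w + c * w ^ 2 = (c + e * w + f * w ^ 2) * w ^ 2) := by
    intro w hw
    rw [hDw]
    have hw0 := ne_zero_of_unit hw
    apply S.disc_pow_eq_one_or hm hw
    · simp only [map_add, map_mul, map_pow, hc, hσe, hσf, map_eq_inv hw]
      field_simp; ring
    · simp only [map_add, map_mul, map_pow, hc, hd, hb, hσe, map_eq_inv hw]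
      field_simp; ring
    · intro z hz hzw
      apply H z w hz hw
      linear_combination hzw
  by_cases hZ : ∃ w, w * σ w = 1 ∧ w ^ 2 * (D.eval w) ^ m ≠ 1
  swap
  · push Not at hZ
    obtain ⟨h, hE⟩ := S.X_pow_sub_one_dvd (f := X ^ 2 * D ^ m - 1) (by
      intro z hz
      simp [hZ z hz])
    obtain ⟨c', κ, hκ, hDκ⟩ := stepanov_quartic h2 h3 hm hq5 S.cast_eq hdeg hE
    exact S.exists_eq_sq_of_eq_C_mul_sq hm hκ hDκ (w := 1) (by simp) (hZ 1 (by simp))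
  obtain ⟨d0, d1, d2, d3, d4, hDc⟩ := exists_quartic_coeffs hdeg
  have coeffs : d0 = b ^ 2 - 4 * c * a ∧ d1 = 2 * b * (c + d) - 4 * (c * b + e * a) ∧
      d2 = (c + d) ^ 2 + 2 * b * e - 4 * (c * c + e * b + f * a) ∧
      d3 = 2 * (c + d) * e - 4 * (e * c + f * b) ∧ d4 = e ^ 2 - 4 * f * c := by
    have hD' : D = C (b ^ 2 - 4 * c * a) + C (2 * b * (c + d) - 4 * (c * b + e * a)) * X
        + C ((c + d) ^ 2 + 2 * b * e - 4 * (c * c + e * b + f * a)) * X ^ 2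
        + C (2 * (c + d) * e - 4 * (e * c + f * b)) * X ^ 3 + C (e ^ 2 - 4 * f * c) * X ^ 4 := by
      rw [hDdef, bezoutDisc]
      simp only [C_add, C_sub, C_mul, C_pow, map_ofNat]
      ring
    have hcf : ∀ i, (C d0 + C d1 * X + C d2 * X ^ 2 + C d3 * X ^ 3 + C d4 * X ^ 4).coeff i = _ :=
      fun i => congrArg (fun P => P.coeff i) (hDc.symm.trans hD')
    have c0 := hcf 0
    have c1 := hcf 1
    have c2 := hcf 2
    have c3 := hcf 3
    have c4 := hcf 4
    simp only [coeff_add, coeff_C_mul, coeff_X, coeff_X_pow, coeff_C] at c0 c1 c2 c3 c4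
    norm_num at c0 c1 c2 c3 c4
    exact ⟨c0, c1, c2, c3, c4⟩
  obtain ⟨hd0, hd1, hd2, hd3, hd4⟩ := coeffs
  have taylor : ∀ w, w * σ w = 1 → w ^ 2 * (D.eval w) ^ m ≠ 1 →
      d0 + d1 * w + d2 * w ^ 2 + d3 * w ^ 3 + d4 * w ^ 4 = 0 ∧
      d1 + 2 * d2 * w + 3 * d3 * w ^ 2 + 4 * d4 * w ^ 3 = 0 ∧
      d2 + 3 * d3 * w + 6 * d4 * w ^ 2 ≠ 0 := by
    intro w hw hne
    obtain ⟨hA, hB, hC⟩ := (pt w hw).resolve_left hne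
    set A := c + e * w + f * w ^ 2 with hA'
    have hb' : b = -(3 * c + d) * w - 3 * e * w ^ 2 - 2 * f * w ^ 3 := by
      rw [hA'] at hB; linear_combination hB
    have ha' : a = -b * w + e * w ^ 3 + f * w ^ 4 := by
      rw [hA'] at hC; linear_combination hC
    refine ⟨?_, ?_, ?_⟩
    · rw [hd0, hd1, hd2, hd3, hd4, ha', hb']; ring
    · rw [hd1, hd2, hd3, hd4, ha', hb']; ring
    · have : d2 + 3 * d3 * w + 6 * d4 * w ^ 2 = -3 * A ^ 2 := by
        have hd' : d = -3 * (e * w + f * w ^ 2) := by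
          have : A * (d + 3 * (e * w + f * w ^ 2)) = 0 := by
            rw [ha', hb'] at pl
            rw [hA']; linear_combination pl
          linear_combination (mul_eq_zero.1 this).resolve_left hA
        rw [hd2, hd3, hd4, ha', hb', hA', hd']
        ring
      rw [this]
      exact mul_ne_zero (neg_ne_zero.2 h3) (pow_ne_zero 2 hA)
  obtain ⟨w0, hw0, hne0⟩ := hZ
  obtain ⟨t0, t1, t2⟩ := taylor w0 hw0 hne0
  set D1 : F[X] := C d4 * X ^ 2 + C (d3 + 2 * w0 * d4) * X
    + C (d2 + 2 * w0 * d3 + 3 * w0 ^ 2 * d4) with hD1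
  have hDD1 : D = (X - C w0) ^ 2 * D1 := by
    have e1 : d1 = -(2 * d2 * w0 + 3 * d3 * w0 ^ 2 + 4 * d4 * w0 ^ 3) := by linear_combination t1
    have e0 : d0 = -(d1 * w0 + d2 * w0 ^ 2 + d3 * w0 ^ 3 + d4 * w0 ^ 4) := by
      linear_combination t0
    rw [hDc, hD1, e0, e1]
    simp only [C_add, C_mul, C_pow, C_neg, map_ofNat]
    ring
  have hD1deg : D1.natDegree ≤ 2 := by rw [hD1]; compute_degree
  have hD1w0 : D1.eval w0 ≠ 0 := by
    have : D1.eval w0 = d2 + 3 * d3 * w0 + 6 * d4 * w0 ^ 2 := by simp [hD1]; ring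
    rw [this]; exact t2
  by_cases hZ1 : ∃ w, w * σ w = 1 ∧ w ^ 2 * (D.eval w) ^ m ≠ 1 ∧ w ≠ w0
  · obtain ⟨w1, hw1, hne1, h10⟩ := hZ1
    obtain ⟨s0, s1, s2⟩ := taylor w1 hw1 hne1
    have hdiff : w1 - w0 ≠ 0 := sub_ne_zero.2 h10
    have r0 : d4 * w1 ^ 2 + (d3 + 2 * w0 * d4) * w1 + (d2 + 2 * w0 * d3 + 3 * w0 ^ 2 * d4) = 0 := by
      apply (mul_eq_zero.1 (?_ : (w1 - w0) ^ 2 * _ = 0)).resolve_left (pow_ne_zero 2 hdiff)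
      linear_combination s0 - t0 - (w1 - w0) * t1
    have r1 : 2 * d4 * w1 + (d3 + 2 * w0 * d4) = 0 := by
      apply (mul_eq_zero.1 (?_ : (w1 - w0) ^ 2 * _ = 0)).resolve_left (pow_ne_zero 2 hdiff)
      linear_combination s1 - t1 - 2 * (w1 - w0) * r0
    have hDsq : D = C d4 * ((X - C w0) * (X - C w1)) ^ 2 := by
      have e3 : d3 = - (2 * w0 * d4) - 2 * d4 * w1 := by linear_combination r1
      have e2 : d2 = -(2 * w0 * d3 + 3 * w0 ^ 2 * d4) - d4 * w1 ^ 2 - (d3 + 2 * w0 * d4) * w1 := by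
        linear_combination r0
      rw [hDD1, hD1, e2, e3]
      simp only [C_add, C_sub, C_mul, C_pow, C_neg, map_ofNat]
      ring
    have hκ : ((X - C w0) * (X - C w1)).natDegree ≤ 2 := by compute_degree
    have hD0 : D ≠ 0 := by
      rw [hDD1]
      refine mul_ne_zero (pow_ne_zero 2 (X_sub_C_ne_zero w0)) ?_
      rintro h; rw [h] at hD1w0; simp at hD1w0
    obtain ⟨w, hw, hwD⟩ := S.exists_unit_eval_ne_zero hD0 (by omega)
    refine S.exists_eq_sq_of_eq_C_mul_sq hm hκ hDsq hw ?_
    by_contra hne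
    apply hwD
    rw [hDc]
    simpa using (taylor w hw hne).1
  · push Not at hZ1
    exfalso
    have hw00 := ne_zero_of_unit hw0
    have key : ∀ w, w * σ w = 1 → ((X - C w0) * (X * D1 ^ m + C w0)).eval w = 0 := by
      intro w hw
      have hww := ne_zero_of_unit hw
      by_cases hww0 : w = w0
      · simp [hww0]
      have h1 : w ^ 2 * (D.eval w) ^ m = 1 := by
        by_contra h; exact hww0 (hZ1 w hw h)
      have hsub : w - w0 ≠ 0 := sub_ne_zero.2 hww0
      have h4 : (w - w0) ^ (2 * m) = -1 / (w * w0) := by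
        apply mul_right_cancel₀ hsub
        rw [← pow_succ, ← hm, ← S.pow, map_sub, map_eq_inv hw, map_eq_inv hw0]
        field_simp; ring
      rw [hDD1, eval_mul, eval_pow, mul_pow, ← pow_mul, eval_sub, eval_X, eval_C, h4] at h1
      field_simp at h1
      simp only [eval_mul, eval_sub, eval_X, eval_C, eval_add, eval_pow]
      linear_combination (w - w0) * (-h1)
    obtain ⟨h, hE⟩ := S.X_pow_sub_one_dvd key
    have hmon : (X ^ (q + 1) - 1 : F[X]).Monic := monic_X_pow_sub_C (1 : F) (by omega)
    have hh0 : h.natDegree = 0 := by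
      by_cases hh : h = 0
      · simp [hh]
      have h1 := hmon.natDegree_mul' hh
      rw [← hE, natDegree_X_pow_sub_one] at h1
      have h4 : ((X - C w0) * (X * D1 ^ m + C w0)).natDegree ≤ q + 1 := by
        have := natDegree_pow_le_of_le m hD1deg
        refine natDegree_mul_le.trans ?_
        have : (X * D1 ^ m + C w0).natDegree ≤ 1 + m * 2 := by
          refine natDegree_add_le_of_degree_le ?_ (by simp)
          refine natDegree_mul_le.trans ?_
          rw [natDegree_X]; omega
        rw [natDegree_X_sub_C]
        omega
      omega
    obtain ⟨g, rfl⟩ := natDegree_eq_zero.1 hh0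
    have hg : g = w0 ^ 2 := by
      have := congrArg (eval 0) hE
      simp at this
      linear_combination -this
    have hd' := congrArg (fun P => (derivative P).eval w0) hE
    simp [S.cast_eq] at hd'
    rw [← S.pow, map_eq_inv hw0, hg] at hd'
    have : w0 * (D1.eval w0) ^ m = 0 := by
      field_simp at hd'
      linear_combination w0 * hd'
    exact mul_ne_zero hw00 (pow_ne_zero m hD1w0) this

end QuadExt

/-- The discriminant of a binary quadratic form under a linear substitution. -/
theorem quadratic_disc_subst {R : Type*} [CommRing R] (k E0 E1 E2 x1 y1 x2 y2 : R) :
    (k * (2 * E2 * (x1 * y1) + E1 * (x1 * y2 + y1 * x2) + 2 * E0 * (x2 * y2))) ^ 2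
      - 4 * (k * (E2 * x1 ^ 2 + E1 * (x1 * x2) + E0 * x2 ^ 2))
        * (k * (E2 * y1 ^ 2 + E1 * (y1 * y2) + E0 * y2 ^ 2))
      = k ^ 2 * ((x1 * y2 - x2 * y1) ^ 2 * (E1 ^ 2 - 4 * E2 * E0)) := by
  ring

/-- The Bezoutian discriminant of a sum of two cubes and a combination of the mixed products. -/
theorem bezoutDisc_cubes {F : Type*} [Field F] (l1 m1 l2 m2 a r s t0 t1 t2 : F)
    {p0 p1 p2 p3 n0 n1 n2 n3 : F}
    (hp0 : p0 = a * (m1 ^ 3 - r * m2 ^ 3))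
    (hp1 : p1 = a * (3 * l1 * m1 ^ 2 - r * (3 * l2 * m2 ^ 2)))
    (hp2 : p2 = a * (3 * l1 ^ 2 * m1 - r * (3 * l2 ^ 2 * m2)))
    (hp3 : p3 = a * (l1 ^ 3 - r * l2 ^ 3))
    (hn0 : n0 = s * p0 + t2 * (m1 ^ 2 * m2) + t1 * (m1 * m2 ^ 2) + t0 * m2 ^ 3)
    (hn1 : n1 = s * p1 + t2 * (2 * l1 * m1 * m2 + m1 ^ 2 * l2)
      + t1 * (l1 * m2 ^ 2 + 2 * l2 * m1 * m2) + t0 * (3 * l2 * m2 ^ 2))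
    (hn2 : n2 = s * p2 + t2 * (2 * l1 * l2 * m1 + l1 ^ 2 * m2)
      + t1 * (m1 * l2 ^ 2 + 2 * l1 * l2 * m2) + t0 * (3 * l2 ^ 2 * m2))
    (hn3 : n3 = s * p3 + t2 * (l1 ^ 2 * l2) + t1 * (l1 * l2 ^ 2) + t0 * l2 ^ 3) :
    bezoutDisc (n1 * p0 - n0 * p1) (n2 * p0 - n0 * p2) (n3 * p0 - n0 * p3) (n2 * p1 - n1 * p2)
      (n3 * p1 - n1 * p3) (n3 * p2 - n2 * p3) =
    C ((a * (l1 * m2 - l2 * m1) ^ 2) ^ 2) *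
      (-3 * (C t1 * (C l1 * X + C m1) ^ 2 + C t0 * ((C l1 * X + C m1) * (C l2 * X + C m2))
          + C (r * t2) * (C l2 * X + C m2) ^ 2) ^ 2
        + 4 * (((C l1 * X + C m1) ^ 3 - C r * (C l2 * X + C m2) ^ 3) *
          (C (t1 ^ 2 - t0 * t2) * (C l1 * X + C m1)
            + C (t0 * t1 - r * t2 ^ 2) * (C l2 * X + C m2)))) := by
  set S1 : F[X] := C l1 * X + C m1 with hS1
  set S2 : F[X] := C l2 * X + C m2 with hS2
  set k : F[X] := -C (a * (l1 * m2 - l2 * m1)) with hk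
  set E2 : F[X] := C t2 * S1 ^ 2 + C t1 * (S1 * S2) + C t0 * S2 ^ 2 with hE2
  set E1 : F[X] := C t1 * S1 ^ 2 + C t0 * (S1 * S2) + C (r * t2) * S2 ^ 2 with hE1
  set E0 : F[X] := C t0 * S1 ^ 2 + C (r * t2) * (S1 * S2) + C (r * t1) * S2 ^ 2 with hE0
  have hA : C (n3 * p0 - n0 * p3) + C (n3 * p1 - n1 * p3) * X + C (n3 * p2 - n2 * p3) * X ^ 2
      = k * (E2 * C l1 ^ 2 + E1 * (C l1 * C l2) + E0 * C l2 ^ 2) := by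
    rw [hn3, hn2, hn1, hn0, hp3, hp2, hp1, hp0, hk, hE2, hE1, hE0, hS1, hS2]
    simp only [C_add, C_sub, C_mul, C_pow, map_ofNat]
    ring
  have hB : C (n2 * p0 - n0 * p2) + C (n3 * p0 - n0 * p3 + (n2 * p1 - n1 * p2)) * X
        + C (n3 * p1 - n1 * p3) * X ^ 2
      = k * (2 * E2 * (C l1 * C m1) + E1 * (C l1 * C m2 + C m1 * C l2)
        + 2 * E0 * (C l2 * C m2)) := by
    rw [hn3, hn2, hn1, hn0, hp3, hp2, hp1, hp0, hk, hE2, hE1, hE0, hS1, hS2]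
    simp only [C_add, C_sub, C_mul, C_pow, map_ofNat]
    ring
  have hC : C (n1 * p0 - n0 * p1) + C (n2 * p0 - n0 * p2) * X + C (n3 * p0 - n0 * p3) * X ^ 2
      = k * (E2 * C m1 ^ 2 + E1 * (C m1 * C m2) + E0 * C m2 ^ 2) := by
    rw [hn3, hn2, hn1, hn0, hp3, hp2, hp1, hp0, hk, hE2, hE1, hE0, hS1, hS2]
    simp only [C_add, C_sub, C_mul, C_pow, map_ofNat]
    ring
  rw [bezoutDisc, hA, hB, hC]
  have hk2 : C ((a * (l1 * m2 - l2 * m1) ^ 2) ^ 2) = k ^ 2 * (C l1 * C m2 - C l2 * C m1) ^ 2 := by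
    rw [hk]; simp only [C_sub, C_mul, C_pow]; ring
  have hdisc : E1 ^ 2 - 4 * E2 * E0 = -3 * E1 ^ 2
        + 4 * ((S1 ^ 3 - C r * S2 ^ 3) * (C (t1 ^ 2 - t0 * t2) * S1
            + C (t0 * t1 - r * t2 ^ 2) * S2)) := by
    rw [hE2, hE1, hE0]
    simp only [C_sub, C_mul, C_pow]
    ring
  rw [hk2, ← hdisc, quadratic_disc_subst]
  exact (mul_assoc _ _ _).symm

theorem linear_comb_eq_zero {F : Type*} [Field F] {l1 m1 l2 m2 α β : F}
    (hD : l1 * m2 - l2 * m1 ≠ 0)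
    (h : C α * (C l1 * X + C m1) + C β * (C l2 * X + C m2) = 0) : α = 0 ∧ β = 0 := by
  have h0 := congrArg (fun P => coeff P 0) h
  have h1 := congrArg (fun P => coeff P 1) h
  simp [coeff_X, coeff_C] at h0 h1
  constructor
  · apply (mul_eq_zero.1 (?_ : α * _ = 0)).resolve_right hD
    linear_combination m2 * h1 - l2 * h0
  · apply (mul_eq_zero.1 (?_ : β * _ = 0)).resolve_right hD
    linear_combination l1 * h0 - m1 * h1

/-- If the Bezoutian discriminant of an irreducible combination `P` of two cubes and a cubic `N` is
a square, then `N` is a combination of the same two cubes. -/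
theorem mem_span_cubes {F : Type*} [Field F] (h2 : (2 : F) ≠ 0) {θ : F} (hθ : θ ^ 2 = -3)
    (l1 m1 l2 m2 a r : F) (hD : l1 * m2 - l2 * m1 ≠ 0) (ha : a ≠ 0) (hr : ∀ t, t ^ 3 ≠ r)
    {P : F[X]} (hP : P = C a * ((C l1 * X + C m1) ^ 3 - C r * (C l2 * X + C m2) ^ 3))
    (hirr : Irreducible P) (hdeg : P.natDegree = 3)
    {p0 p1 p2 p3 n0 n1 n2 n3 : F}
    (hp0 : p0 = a * (m1 ^ 3 - r * m2 ^ 3))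
    (hp1 : p1 = a * (3 * l1 * m1 ^ 2 - r * (3 * l2 * m2 ^ 2)))
    (hp2 : p2 = a * (3 * l1 ^ 2 * m1 - r * (3 * l2 ^ 2 * m2)))
    (hp3 : p3 = a * (l1 ^ 3 - r * l2 ^ 3))
    (hκ : ∃ κ : F[X], κ.natDegree ≤ 2 ∧ bezoutDisc (n1 * p0 - n0 * p1) (n2 * p0 - n0 * p2)
      (n3 * p0 - n0 * p3) (n2 * p1 - n1 * p2) (n3 * p1 - n1 * p3) (n3 * p2 - n2 * p3) = κ ^ 2) :
    ∃ A B, n0 = A * m1 ^ 3 + B * m2 ^ 3 ∧ n1 = A * (3 * l1 * m1 ^ 2) + B * (3 * l2 * m2 ^ 2) ∧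
      n2 = A * (3 * l1 ^ 2 * m1) + B * (3 * l2 ^ 2 * m2) ∧ n3 = A * l1 ^ 3 + B * l2 ^ 3 := by
  obtain ⟨κ, hκ2, hκ⟩ := hκ
  set D := l1 * m2 - l2 * m1 with hDdef
  obtain ⟨s, t2, t1, t0, hn0, hn1, hn2, hn3⟩ : ∃ s t2 t1 t0 : F,
      n0 = s * p0 + t2 * (m1 ^ 2 * m2) + t1 * (m1 * m2 ^ 2) + t0 * m2 ^ 3 ∧
      n1 = s * p1 + t2 * (2 * l1 * m1 * m2 + m1 ^ 2 * l2)
        + t1 * (l1 * m2 ^ 2 + 2 * l2 * m1 * m2) + t0 * (3 * l2 * m2 ^ 2) ∧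
      n2 = s * p2 + t2 * (2 * l1 * l2 * m1 + l1 ^ 2 * m2)
        + t1 * (m1 * l2 ^ 2 + 2 * l1 * l2 * m2) + t0 * (3 * l2 ^ 2 * m2) ∧
      n3 = s * p3 + t2 * (l1 ^ 2 * l2) + t1 * (l1 * l2 ^ 2) + t0 * l2 ^ 3 := by
    set T := (n3 * m2 ^ 3 - n2 * m2 ^ 2 * l2 + n1 * m2 * l2 ^ 2 - n0 * l2 ^ 3) / D ^ 3 with hT
    refine ⟨T / a,
      (-3 * n3 * m2 ^ 2 * m1 + n2 * (2 * m1 * m2 * l2 + m2 ^ 2 * l1)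
        - n1 * (m1 * l2 ^ 2 + 2 * m2 * l1 * l2) + 3 * n0 * l1 * l2 ^ 2) / D ^ 3,
      (3 * n3 * m2 * m1 ^ 2 - n2 * (2 * m1 * m2 * l1 + m1 ^ 2 * l2)
        + n1 * (m2 * l1 ^ 2 + 2 * m1 * l1 * l2) - 3 * n0 * l1 ^ 2 * l2) / D ^ 3,
      (-n3 * m1 ^ 3 + n2 * m1 ^ 2 * l1 - n1 * m1 * l1 ^ 2 + n0 * l1 ^ 3) / D ^ 3 + r * T,
      ?_, ?_, ?_, ?_⟩
    · rw [hp0, hT]; field_simp; rw [hDdef]; ring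
    · rw [hp1, hT]; field_simp; rw [hDdef]; ring
    · rw [hp2, hT]; field_simp; rw [hDdef]; ring
    · rw [hp3, hT]; field_simp; rw [hDdef]; ring
  rw [bezoutDisc_cubes l1 m1 l2 m2 a r s t0 t1 t2 hp0 hp1 hp2 hp3 hn0 hn1 hn2 hn3] at hκ
  set S1 : F[X] := C l1 * X + C m1 with hS1
  set S2 : F[X] := C l2 * X + C m2 with hS2
  set M : F[X] := C (t1 ^ 2 - t0 * t2) * S1 + C (t0 * t1 - r * t2 ^ 2) * S2 with hM
  set E : F[X] := C t1 * S1 ^ 2 + C t0 * (S1 * S2) + C (r * t2) * S2 ^ 2 with hE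
  have hE2 : E.natDegree ≤ 2 := by rw [hE, hS1, hS2]; compute_degree
  set k1 : F[X] := C (a * D ^ 2 * θ) * E with hk1
  have hk12 : k1.natDegree ≤ 2 := (natDegree_C_mul_le _ _).trans hE2
  have hfac : (κ - k1) * (κ + k1) = P * (C (4 * a * D ^ 4) * M) := by
    have h3 : C θ ^ 2 = (-3 : F[X]) := by rw [← C_pow, hθ, C_neg]; rfl
    have : (κ - k1) * (κ + k1) = κ ^ 2 - k1 ^ 2 := by ring
    rw [this, ← hκ, hk1, hP]
    simp only [C_mul, C_pow, map_ofNat]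
    linear_combination - C a ^ 2 * C D ^ 4 * E ^ 2 * h3
  have hz : ∀ f : F[X], f.natDegree ≤ 2 → P ∣ f → f = 0 := by
    intro f hf hPf
    by_contra hf0
    have := natDegree_le_of_dvd hPf hf0
    omega
  have h0 : (κ - k1) * (κ + k1) = 0 := by
    rcases hirr.prime.dvd_or_dvd (Dvd.intro _ hfac.symm) with h | h
    · rw [hz _ ((natDegree_sub_le _ _).trans (max_le hκ2 hk12)) h, zero_mul]
    · rw [hz _ ((natDegree_add_le _ _).trans (max_le hκ2 hk12)) h, mul_zero]
  rw [h0] at hfac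
  have hM0 : M = 0 := by
    have h4 : (4 * a * D ^ 4 : F) ≠ 0 := by
      have : (4 : F) = 2 * 2 := by norm_num
      rw [this]
      exact mul_ne_zero (mul_ne_zero (mul_ne_zero h2 h2) ha) (pow_ne_zero 4 hD)
    have := (mul_eq_zero.1 hfac.symm).resolve_left hirr.ne_zero
    exact (mul_eq_zero.1 this).resolve_left (C_ne_zero.2 h4)
  obtain ⟨e1, e2⟩ := linear_comb_eq_zero hD hM0
  have ht2 : t2 = 0 := by
    by_contra ht2
    apply hr (t1 / t2)
    field_simp
    linear_combination t1 * e1 + t2 * e2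
  have ht1 : t1 = 0 := by
    rw [ht2] at e1
    simpa using e1
  refine ⟨s * a, -s * a * r + t0, ?_, ?_, ?_, ?_⟩
  · rw [hn0, hp0, ht1, ht2]; ring
  · rw [hn1, hp1, ht1, ht2]; ring
  · rw [hn2, hp2, ht1, ht2]; ring
  · rw [hn3, hp3, ht1, ht2]; ring

theorem mem_range_of_pow_card_eq {F K : Type*} [Field F] [Fintype F] [Field K] [Algebra F K] {x : K}
    (hx : x ^ Fintype.card F = x) : ∃ a, algebraMap F K a = x := by
  by_contra! h
  have hne : (X ^ Fintype.card F - X : K[X]) ≠ 0 :=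
    FiniteField.X_pow_card_sub_X_ne_zero K Fintype.one_lt_card
  refine hne (eq_zero_of_natDegree_lt_card_of_eval_eq_zero _
    (f := fun i : Option F => i.elim x (algebraMap F K)) ?_ ?_ ?_)
  · rintro (_ | a) (_ | b) hab
    · rfl
    · exact absurd hab.symm (h b)
    · exact absurd hab (h a)
    · exact congrArg some ((algebraMap F K).injective hab)
  · rintro (_ | a)
    · simp [hx]
    · simp [← map_pow, FiniteField.pow_card]
  · rw [FiniteField.X_pow_card_sub_X_natDegree_eq K Fintype.one_lt_card, Fintype.card_option]
    omega

/-- The discriminant of an irreducible cubic over a finite field is a square. -/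
theorem exists_sq_eq_disc {F K : Type*} [Field F] [Fintype F] [Field K] [Algebra F K] {A B : F}
    (hroot : ∀ t, t ^ 3 + 3 * A * t + 2 * B ≠ 0) {x : K}
    (hx : x ^ 3 + algebraMap F K (3 * A) * x + algebraMap F K (2 * B) = 0) :
    ∃ d, d ^ 2 = -108 * (B ^ 2 + A ^ 3) := by
  set φ := FiniteField.frobeniusAlgHom F K with hφ
  have hφx : ∀ x, φ x = x ^ Fintype.card F := fun x => rfl
  set a := algebraMap F K (3 * A) with ha
  set b := algebraMap F K (2 * B) with hb
  have hfix : ∀ y, φ y = y → ∃ c, algebraMap F K c = y := fun y hy =>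
    mem_range_of_pow_card_eq ((hφx y).symm.trans hy)
  have hnr : ∀ y, y ^ 3 + a * y + b = 0 → φ y ≠ y := by
    intro y hy hfy
    obtain ⟨c, rfl⟩ := hfix y hfy
    apply hroot c
    apply (algebraMap F K).injective
    rw [map_zero, ← hy, ha, hb]
    simp
  have hφr : ∀ y, y ^ 3 + a * y + b = 0 → φ y ^ 3 + a * φ y + b = 0 := by
    intro y hy
    have h := congrArg φ hy
    rwa [map_add, map_add, map_mul, map_pow, ha, hb, AlgHom.commutes, AlgHom.commutes,
      map_zero] at h
  set y := φ x with hy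
  have hy0 := hφr x hx
  have hxy : y - x ≠ 0 := sub_ne_zero.2 (hnr x hx)
  set z := φ y with hz
  have hz0 := hφr y hy0
  have hzy : z - y ≠ 0 := sub_ne_zero.2 (hnr y hy0)
  have e1 : y ^ 2 + y * x + x ^ 2 + a = 0 := by
    apply (mul_eq_zero.1 (?_ : (y - x) * _ = 0)).resolve_left hxy
    linear_combination hy0 - hx
  have e2 : z ^ 2 + z * y + y ^ 2 + a = 0 := by
    apply (mul_eq_zero.1 (?_ : (z - y) * _ = 0)).resolve_left hzy
    linear_combination hz0 - hy0
  have e3 : (z - x) * (x + y + z) = 0 := by linear_combination e2 - e1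
  have e4 : (-x - y) ^ 3 + a * (-x - y) + b = 0 := by linear_combination hx - (2 * x + y) * e1
  have hzx : z ≠ x := by
    intro h
    apply hnr _ e4
    rw [map_sub, map_neg, ← hy, ← hz, h]; ring
  have hsum := (mul_eq_zero.1 e3).resolve_left (sub_ne_zero.2 hzx)
  have hφz : φ z = x := by
    have : z = -x - y := by linear_combination hsum
    rw [this, map_sub, map_neg, ← hy, ← hz, this]; ring
  obtain ⟨d, hd⟩ := hfix ((x - y) * (y - z) * (z - x)) (by
    simp only [map_mul, map_sub, ← hy, ← hz, hφz]; ring)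
  refine ⟨d, (algebraMap F K).injective ?_⟩
  rw [map_pow, hd]
  have h4 : (algebraMap F K) (-108 * (B ^ 2 + A ^ 3)) = -27 * b ^ 2 - 4 * a ^ 3 := by
    rw [ha, hb]; simp only [map_mul, map_neg, map_add, map_pow, map_ofNat]; ring
  rw [h4]
  have hz' : z = -x - y := by linear_combination hsum
  have ha' : a = -(y ^ 2 + y * x + x ^ 2) := by linear_combination e1
  have hb' : b = -(x ^ 3 + a * x) := by linear_combination hx
  rw [hb', ha', hz']; ring

/-- An irreducible cubic over a finite field containing the cube roots of unity is a combination of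
two cubes of linear forms. -/
theorem exists_eq_cubes {F : Type*} [Field F] [Fintype F] (h2 : (2 : F) ≠ 0) (h3 : (3 : F) ≠ 0)
    {θ : F} (hθ : θ ^ 2 = -3) {P : F[X]} (hmon : P.Monic) (hdeg : P.natDegree = 3)
    (hirr : Irreducible P) :
    ∃ l1 m1 l2 m2 a r : F, l1 * m2 - l2 * m1 ≠ 0 ∧ a ≠ 0 ∧ (∀ t, t ^ 3 ≠ r) ∧
      P = C a * ((C l1 * X + C m1) ^ 3 - C r * (C l2 * X + C m2) ^ 3) := by
  have hnoroot : ∀ t, P.eval t ≠ 0 := by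
    intro t ht
    have := degree_eq_one_of_irreducible_of_root hirr ht
    rw [degree_eq_natDegree hmon.ne_zero, hdeg] at this
    norm_num at this
  have hθ0 : θ ≠ 0 := by
    rintro rfl; apply h3; linear_combination hθ
  suffices ∃ l1 m1 l2 m2 a r : F, l1 * m2 - l2 * m1 ≠ 0 ∧ a ≠ 0 ∧
      P = C a * ((C l1 * X + C m1) ^ 3 - C r * (C l2 * X + C m2) ^ 3) by
    obtain ⟨l1, m1, l2, m2, a, r, hD, ha, hP⟩ := this
    refine ⟨l1, m1, l2, m2, a, r, hD, ha, ?_, hP⟩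
    intro t ht
    have hP' : P = (C (l1 - t * l2) * X + C (m1 - t * m2)) * (C a *
      ((C l1 * X + C m1) ^ 2 + C t * ((C l1 * X + C m1) * (C l2 * X + C m2))
        + C t ^ 2 * (C l2 * X + C m2) ^ 2)) := by
      rw [hP, ← ht]; simp only [C_sub, C_mul, C_pow]; ring
    by_cases h : l1 - t * l2 = 0
    · have h1 : P = C (a * (m1 - t * m2)) *
        ((C l1 * X + C m1) ^ 2 + C t * ((C l1 * X + C m1) * (C l2 * X + C m2))
        + C t ^ 2 * (C l2 * X + C m2) ^ 2) := by
        rw [hP', h]; simp only [C_sub, C_mul, C_0]; ring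
      have h4 : P.natDegree ≤ 2 := by rw [h1]; compute_degree
      omega
    · apply hnoroot (-(m1 - t * m2) / (l1 - t * l2))
      rw [hP', eval_mul]
      have : (C (l1 - t * l2) * X + C (m1 - t * m2)).eval (-(m1 - t * m2) / (l1 - t * l2)) = 0 := by
        simp only [eval_add, eval_mul, eval_C, eval_X]; field_simp; ring
      rw [this, zero_mul]
  obtain ⟨c0, c1, c2, hP⟩ : ∃ c0 c1 c2, P = X ^ 3 + C c2 * X ^ 2 + C c1 * X + C c0 := by
    refine ⟨P.coeff 0, P.coeff 1, P.coeff 2, ?_⟩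
    conv_lhs => rw [hmon.as_sum, hdeg]
    simp [Finset.sum_range_succ]; ring
  obtain ⟨e, rfl⟩ : ∃ e, c2 = 3 * e := ⟨c2 / 3, by field_simp⟩
  obtain ⟨A, rfl⟩ : ∃ A, c1 = 3 * A + 3 * e ^ 2 := ⟨(c1 - 3 * e ^ 2) / 3, by field_simp; ring⟩
  obtain ⟨B, rfl⟩ : ∃ B, c0 = 2 * B + 3 * A * e + e ^ 3 :=
    ⟨(c0 - 3 * A * e - e ^ 3) / 2, by field_simp; ring⟩
  have hP' : P = (X + C e) ^ 3 + 3 * C A * (X + C e) + 2 * C B := by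
    rw [hP]; simp only [C_add, C_mul, C_pow, map_ofNat]; ring
  have hroot : ∀ t, t ^ 3 + 3 * A * t + 2 * B ≠ 0 := by
    intro t ht
    apply hnoroot (t - e)
    rw [hP']; simp; linear_combination ht
  by_cases hA : A = 0
  · refine ⟨1, e, 0, 1, 1, -2 * B, by simp, one_ne_zero, ?_⟩
    rw [hP', hA]
    simp only [C_1, C_0, C_mul, C_neg, map_ofNat]; ring
  obtain ⟨d, hd⟩ : ∃ d, d ^ 2 = -108 * (B ^ 2 + A ^ 3) := by
    have : Fact (Irreducible P) := ⟨hirr⟩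
    refine exists_sq_eq_disc (K := AdjoinRoot P) hroot
      (x := AdjoinRoot.root P + AdjoinRoot.of P e) ?_
    have h : ∀ Q, P = Q → eval₂ (AdjoinRoot.of P) (AdjoinRoot.root P) Q = 0 := by
      rintro Q rfl; exact AdjoinRoot.eval₂_root P
    have h' := h (_ + C 3 * C A * _ + C 2 * C B) hP'
    simpa [eval₂_add, eval₂_mul, eval₂_pow] using h'
  obtain ⟨δ, hδ⟩ : ∃ δ, δ ^ 2 = B ^ 2 + A ^ 3 := by
    refine ⟨d / (6 * θ), ?_⟩
    have : (6 : F) ≠ 0 := by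
      have : (6 : F) = 2 * 3 := by norm_num
      rw [this]; exact mul_ne_zero h2 h3
    field_simp
    linear_combination hd - 36 * (B ^ 2 + A ^ 3) * hθ
  have hδ0 : δ ≠ 0 := by
    rintro rfl
    apply hroot (-B / A)
    field_simp
    linear_combination B * hδ
  have hBδ : -B - δ ≠ 0 := by
    intro h
    have : A ^ 3 = 0 := by linear_combination (B - δ) * h - hδ
    exact hA (by simpa using this)
  obtain ⟨α, hα⟩ : ∃ α, α = (-B + δ) / A := ⟨_, rfl⟩
  obtain ⟨β, hβ⟩ : ∃ β, β = (-B - δ) / A := ⟨_, rfl⟩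
  have hβ0 : β ≠ 0 := by rw [hβ]; exact div_ne_zero hBδ hA
  have hαβ : β - α ≠ 0 := by
    have : β - α = 2 * (-δ / A) := by rw [hα, hβ]; field_simp; ring
    rw [this]
    exact mul_ne_zero h2 (div_ne_zero (neg_ne_zero.2 hδ0) hA)
  have hs : α * β = -A := by rw [hα, hβ]; field_simp; linear_combination -hδ
  have ht : α * β * (α + β) = 2 * B := by rw [hs, hα, hβ]; field_simp; ring
  refine ⟨1, e - α, 1, e - β, β / (β - α), α / β, ?_, div_ne_zero hβ0 hαβ, ?_⟩
  · rw [show 1 * (e - β) - 1 * (e - α) = -(β - α) by ring]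
    exact neg_ne_zero.2 hαβ
  · have hk : C (β / (β - α)) * (C β - C α) = (C β : F[X]) := by
      rw [← C_sub, ← C_mul]; congr 1; field_simp
    have hk2 : C (α / β) * C β = (C α : F[X]) := by
      rw [← C_mul]; congr 1; field_simp
    have hs' : C α * C β = -(C A : F[X]) := by rw [← C_mul, hs, C_neg]
    have ht' : C α * C β * (C α + C β) = 2 * (C B : F[X]) := by
      rw [← C_add, ← C_mul, ← C_mul, ht, C_mul]; rfl
    apply mul_left_cancel₀ (C_ne_zero.2 hαβ)
    rw [hP']
    simp only [C_1, C_sub]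
    linear_combination -((X + C e - C α) ^ 3 - C (α / β) * (X + C e - C β) ^ 3) * hk
      + (X + C e - C β) ^ 3 * hk2 + 3 * (X + C e) * (C β - C α) * hs' - (C β - C α) * ht'

/-- Two pairs of independent linear forms whose cubes satisfy a linear relation with nonzero
coefficients agree up to order and scaling. -/
theorem linear_forms_of_cubes {F : Type*} [Field F] (h3 : (3 : F) ≠ 0) {l1 m1 l2 m2 k1 n1 k2 n2 : F}
    (hD : l1 * m2 - l2 * m1 ≠ 0) (hD' : k1 * n2 - k2 * n1 ≠ 0) {a b A B : F} (ha : a ≠ 0)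
    (hb : b ≠ 0) (E0 : a * n1 ^ 3 + b * n2 ^ 3 = A * m1 ^ 3 + B * m2 ^ 3)
    (E1 : a * (3 * k1 * n1 ^ 2) + b * (3 * k2 * n2 ^ 2)
      = A * (3 * l1 * m1 ^ 2) + B * (3 * l2 * m2 ^ 2))
    (E2 : a * (3 * k1 ^ 2 * n1) + b * (3 * k2 ^ 2 * n2)
      = A * (3 * l1 ^ 2 * m1) + B * (3 * l2 ^ 2 * m2))
    (E3 : a * k1 ^ 3 + b * k2 ^ 3 = A * l1 ^ 3 + B * l2 ^ 3) :
    (∃ x y, k1 = x * l1 ∧ n1 = x * m1 ∧ k2 = y * l2 ∧ n2 = y * m2) ∨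
      (∃ x y, k1 = x * l2 ∧ n1 = x * m2 ∧ k2 = y * l1 ∧ n2 = y * m1) := by
  have decomp : ∀ k n : F, ∃ x y, k = x * l1 + y * l2 ∧ n = x * m1 + y * m2 := fun k n =>
    ⟨(k * m2 - n * l2) / (l1 * m2 - l2 * m1), (n * l1 - k * m1) / (l1 * m2 - l2 * m1),
      by rw [div_mul_eq_mul_div, div_mul_eq_mul_div, ← add_div, eq_div_iff hD]; ring,
      by rw [div_mul_eq_mul_div, div_mul_eq_mul_div, ← add_div, eq_div_iff hD]; ring⟩
  obtain ⟨x1, y1, rfl, rfl⟩ := decomp k1 n1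
  obtain ⟨x2, y2, rfl, rfl⟩ := decomp k2 n2
  have hdet : x1 * y2 - x2 * y1 ≠ 0 := by
    intro h
    apply hD'
    linear_combination (l1 * m2 - l2 * m1) * h
  have hD3 : 3 * (l1 * m2 - l2 * m1) ^ 3 ≠ 0 := mul_ne_zero h3 (pow_ne_zero 3 hD)
  have t2 : a * x1 ^ 2 * y1 + b * x2 ^ 2 * y2 = 0 := by
    apply (mul_eq_zero.1 (?_ : 3 * (l1 * m2 - l2 * m1) ^ 3 * _ = 0)).resolve_left hD3
    linear_combination (-3 * m2 ^ 2 * m1) * E3 + (2 * m1 * m2 * l2 + m2 ^ 2 * l1) * E2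
        - (m1 * l2 ^ 2 + 2 * m2 * l1 * l2) * E1 + 3 * l1 * l2 ^ 2 * E0
  have t1 : a * x1 * y1 ^ 2 + b * x2 * y2 ^ 2 = 0 := by
    apply (mul_eq_zero.1 (?_ : 3 * (l1 * m2 - l2 * m1) ^ 3 * _ = 0)).resolve_left hD3
    linear_combination (3 * m2 * m1 ^ 2) * E3 - (2 * m1 * m2 * l1 + m1 ^ 2 * l2) * E2
        + (m2 * l1 ^ 2 + 2 * m1 * l1 * l2) * E1 - 3 * l1 ^ 2 * l2 * E0
  have p1 : a * (x1 * y1) = 0 := by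
    apply (mul_eq_zero.1 (?_ : (x1 * y2 - x2 * y1) * _ = 0)).resolve_left hdet
    linear_combination y2 * t2 - x2 * t1
  have p2 : b * (x2 * y2) = 0 := by
    apply (mul_eq_zero.1 (?_ : (x1 * y2 - x2 * y1) * _ = 0)).resolve_left hdet
    linear_combination -y1 * t2 + x1 * t1
  have q1 := (mul_eq_zero.1 p1).resolve_left ha
  have q2 := (mul_eq_zero.1 p2).resolve_left hb
  rcases mul_eq_zero.1 q1 with h1 | h1 <;> rcases mul_eq_zero.1 q2 with h2 | h2
  · exact absurd (by rw [h1, h2]; ring) hdet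
  · exact Or.inr ⟨y1, x2, by rw [h1]; ring, by rw [h1]; ring, by rw [h2]; ring, by rw [h2]; ring⟩
  · exact Or.inl ⟨x1, y2, by rw [h1]; ring, by rw [h1]; ring, by rw [h2]; ring, by rw [h2]; ring⟩
  · exact absurd (by rw [h1, h2]; ring) hdet

theorem cubic_coeffs {F : Type*} [Field F] (p0 p1 p2 p3 : F) :
    (C p0 + C p1 * X + C p2 * X ^ 2 + C p3 * X ^ 3).coeff 0 = p0 ∧
    (C p0 + C p1 * X + C p2 * X ^ 2 + C p3 * X ^ 3).coeff 1 = p1 ∧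
    (C p0 + C p1 * X + C p2 * X ^ 2 + C p3 * X ^ 3).coeff 2 = p2 ∧
    (C p0 + C p1 * X + C p2 * X ^ 2 + C p3 * X ^ 3).coeff 3 = p3 := by
  refine ⟨?_, ?_, ?_, ?_⟩ <;> simp [coeff_X, coeff_C, coeff_X_pow]

theorem moebius3_cubic {F : Type*} [Field F] (q : ℕ) (u v p0 p1 p2 p3 : F) :
    moebius3 q u v (C p0 + C p1 * X + C p2 * X ^ 2 + C p3 * X ^ 3) =
      C p0 * (C u + C (v ^ q) * X) ^ 3
      + C p1 * (C v + C (u ^ q) * X) * (C u + C (v ^ q) * X) ^ 2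
      + C p2 * (C v + C (u ^ q) * X) ^ 2 * (C u + C (v ^ q) * X)
      + C p3 * (C v + C (u ^ q) * X) ^ 3 := by
  obtain ⟨c0, c1, c2, c3⟩ := cubic_coeffs p0 p1 p2 p3
  simp only [moebius3, Finset.sum_range_succ, Finset.sum_range_zero, c0, c1, c2, c3,
    Nat.sub_self, Nat.reduceSub]
  ring

theorem cubes_expand {F : Type*} [Field F] (a b l1 m1 l2 m2 : F) :
    C a * (C l1 * X + C m1) ^ 3 + C b * (C l2 * X + C m2) ^ 3 =
      C (a * m1 ^ 3 + b * m2 ^ 3) + C (a * (3 * l1 * m1 ^ 2) + b * (3 * l2 * m2 ^ 2)) * X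
        + C (a * (3 * l1 ^ 2 * m1) + b * (3 * l2 ^ 2 * m2)) * X ^ 2
        + C (a * l1 ^ 3 + b * l2 ^ 3) * X ^ 3 := by
  simp only [C_add, C_mul, C_pow, map_ofNat]; ring

theorem cubic_coeffs_inj {F : Type*} [Field F] {p0 p1 p2 p3 n0 n1 n2 n3 : F}
    (h : C p0 + C p1 * X + C p2 * X ^ 2 + C p3 * X ^ 3
      = C n0 + C n1 * X + C n2 * X ^ 2 + C n3 * X ^ 3) :
    p0 = n0 ∧ p1 = n1 ∧ p2 = n2 ∧ p3 = n3 := by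
  obtain ⟨c0, c1, c2, c3⟩ := cubic_coeffs p0 p1 p2 p3
  rw [h] at c0 c1 c2 c3
  obtain ⟨d0, d1, d2, d3⟩ := cubic_coeffs n0 n1 n2 n3
  exact ⟨c0.symm.trans d0, c1.symm.trans d1, c2.symm.trans d2, c3.symm.trans d3⟩

theorem moebius3_cubes {F : Type*} [Field F] (q : ℕ) (u v a b l1 m1 l2 m2 : F) :
    moebius3 q u v (C a * (C l1 * X + C m1) ^ 3 + C b * (C l2 * X + C m2) ^ 3) =
      C a * (C (l1 * u ^ q + m1 * v ^ q) * X + C (l1 * v + m1 * u)) ^ 3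
        + C b * (C (l2 * u ^ q + m2 * v ^ q) * X + C (l2 * v + m2 * u)) ^ 3 := by
  rw [cubes_expand, moebius3_cubic]
  generalize u ^ q = U
  generalize v ^ q = V
  simp only [C_add, C_mul, C_pow, map_ofNat]; ring

namespace QuadExt

variable {F : Type*} [Field F] [Fintype F] {q : ℕ} {σ : F →+* F}

/-- A combination of two cubes cannot satisfy Condition (1) when multiplying one of the forms by a
cube root of unity acts on the unit circle. -/
theorem not_condition1_of_cubes (S : QuadExt F q σ) {l1 m1 l2 m2 a r A B ω c w Z1 Z2 : F}
    {P : F[X]} (hP : P = C a * ((C l1 * X + C m1) ^ 3 - C r * (C l2 * X + C m2) ^ 3))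
    (hω : ω ^ 3 = 1) (hω1 : ω ≠ 1) (hw : w * σ w = 1) (hW : l1 * w + m1 ≠ 0)
    (hV : l2 * w + m2 ≠ 0) (e1 : l1 * Z1 + m1 * Z2 = ω * (l1 * w + m1))
    (e2 : l2 * Z1 + m2 * Z2 = l2 * w + m2) (z1 : Z1 = c * w * σ Z2) (z2 : Z2 = c * w * σ Z1)
    (hN : ∀ z, z * σ z = 1 → z ^ 3 * σ (P.eval z) = A * (l1 * z + m1) ^ 3 + B * (l2 * z + m2) ^ 3)
    (hC : Condition1 q 3 P) : False := by
  have hω0 : ω ≠ 0 := by rintro rfl; simp at hω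
  have hZ2 : Z2 ≠ 0 := by
    intro h
    rw [h, map_zero, mul_zero] at z1
    rw [z1, h] at e1
    exact mul_ne_zero hω0 hW (by linear_combination -e1)
  have hσZ2 : σ Z2 ≠ 0 := (map_ne_zero σ).2 hZ2
  obtain ⟨z, hz⟩ : ∃ z, z = Z1 / Z2 := ⟨_, rfl⟩
  have hz' : Z1 = z * Z2 := by rw [hz]; field_simp
  have hzu : z * σ z = 1 := by
    rw [hz, map_div₀, div_mul_div_comm, div_eq_one_iff_eq (mul_ne_zero hZ2 hσZ2)]
    linear_combination σ Z1 * z1 - σ Z2 * z2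
  have k1 : Z2 * (l1 * z + m1) = ω * (l1 * w + m1) := by rw [← e1, hz']; ring
  have k2 : Z2 * (l2 * z + m2) = l2 * w + m2 := by rw [← e2, hz']; ring
  have k1' : Z2 ^ 3 * (l1 * z + m1) ^ 3 = (l1 * w + m1) ^ 3 := by
    rw [← mul_pow, k1, mul_pow, hω, one_mul]
  have k2' : Z2 ^ 3 * (l2 * z + m2) ^ 3 = (l2 * w + m2) ^ 3 := by rw [← mul_pow, k2]
  have hev : ∀ z, P.eval z = a * ((l1 * z + m1) ^ 3 - r * (l2 * z + m2) ^ 3) := by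
    intro z; rw [hP]; simp
  have hzw : z = w := by
    refine (S.condition1_iff P).1 hC z w hzu hw ?_
    rw [hN w hw, hN z hzu, hev, hev, ← k1', ← k2']
    ring
  rw [hzw] at k1 k2
  have h1 : Z2 = 1 := by
    apply mul_right_cancel₀ hV; rw [k2, one_mul]
  apply hω1
  apply mul_right_cancel₀ hW
  rw [← k1, h1]

end QuadExt

namespace QuadExt

variable {F : Type*} [Field F] {q : ℕ} {σ : F →+* F}

theorem eval_cubic_conj (p0 p1 p2 p3 : F) {z : F} (hz : z * σ z = 1) :
    z ^ 3 * σ (p0 + p1 * z + p2 * z ^ 2 + p3 * z ^ 3)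
      = σ p3 + σ p2 * z + σ p1 * z ^ 2 + σ p0 * z ^ 3 := by
  have hz0 := ne_zero_of_unit hz
  simp only [map_add, map_mul, map_pow, map_eq_inv hz]
  field_simp
  ring

variable [Fintype F]

/-- The structure of the irreducible cubics satisfying Condition (1): they are combinations of two
cubes of linear forms which are fixed or exchanged, up to scaling, by the unit circle involution. -/
theorem exists_cubes_of_good (S : QuadExt F q σ) {ω : F} (hω : ω ^ 2 + ω + 1 = 0) {P : F[X]}
    (hP : Good q P) :
    ∃ l1 m1 l2 m2 a r : F, l1 * m2 - l2 * m1 ≠ 0 ∧ a ≠ 0 ∧ (∀ t, t ^ 3 ≠ r) ∧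
      P = C a * ((C l1 * X + C m1) ^ 3 - C r * (C l2 * X + C m2) ^ 3) ∧
      ((σ ω ≠ ω ∧ ∃ x y, σ m1 = x * l1 ∧ σ l1 = x * m1 ∧ σ m2 = y * l2 ∧ σ l2 = y * m2) ∨
        (σ ω ≠ ω ^ 2 ∧ ∃ x y, σ m1 = x * l2 ∧ σ l1 = x * m2 ∧ σ m2 = y * l1 ∧ σ l2 = y * m1)) := by
  obtain ⟨hmon, hdeg, hirr, hC⟩ := hP
  have h2 := S.two_ne
  have h3 := S.three_ne
  have hθ : (2 * ω + 1) ^ 2 = -3 := by linear_combination 4 * hω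
  have hω3 : ω ^ 3 = 1 := by linear_combination (ω - 1) * hω
  have hω1 : ω ≠ 1 := by rintro rfl; apply h3; linear_combination hω
  have hω0 : ω ≠ 0 := by rintro rfl; simp at hω
  obtain ⟨l1, m1, l2, m2, a, r, hD, ha, hr, hP⟩ := exists_eq_cubes h2 h3 hθ hmon hdeg hirr
  have hr0 : r ≠ 0 := fun h => hr 0 (by rw [h]; simp)
  refine ⟨l1, m1, l2, m2, a, r, hD, ha, hr, hP, ?_⟩
  obtain ⟨p0, hp0⟩ : ∃ p0, p0 = a * (m1 ^ 3 - r * m2 ^ 3) := ⟨_, rfl⟩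
  obtain ⟨p1, hp1⟩ : ∃ p1, p1 = a * (3 * l1 * m1 ^ 2 - r * (3 * l2 * m2 ^ 2)) := ⟨_, rfl⟩
  obtain ⟨p2, hp2⟩ : ∃ p2, p2 = a * (3 * l1 ^ 2 * m1 - r * (3 * l2 ^ 2 * m2)) := ⟨_, rfl⟩
  obtain ⟨p3, hp3⟩ : ∃ p3, p3 = a * (l1 ^ 3 - r * l2 ^ 3) := ⟨_, rfl⟩
  have hev : ∀ z, P.eval z = p0 + p1 * z + p2 * z ^ 2 + p3 * z ^ 3 := by
    intro z; rw [hP, hp0, hp1, hp2, hp3]; simp; ring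
  have hcj : ∀ z, z * σ z = 1 →
      z ^ 3 * σ (P.eval z) = σ p3 + σ p2 * z + σ p1 * z ^ 2 + σ p0 * z ^ 3 := by
    intro z hz; rw [hev, eval_cubic_conj _ _ _ _ hz]
  obtain ⟨A, B, hn0, hn1, hn2, hn3⟩ := mem_span_cubes h2 hθ l1 m1 l2 m2 a r hD ha hr hP hirr hdeg
    hp0 hp1 hp2 hp3 (n0 := σ p3) (n1 := σ p2) (n2 := σ p1) (n3 := σ p0) (by
      apply S.bezoutDisc_isSquare
      · simp only [map_sub, map_mul, S.invol]; ring
      · simp only [map_sub, map_mul, S.invol]; ring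
      · simp only [map_sub, map_mul, S.invol]; ring
      · simp only [map_sub, map_mul, S.invol]; ring
      · ring
      · intro z w hz hw hR
        refine (S.condition1_iff P).1 hC z w hz hw ?_
        rw [hcj z hz, hcj w hw, hev, hev]
        linear_combination (w - z) * hR)
  have hN : ∀ z, z * σ z = 1 →
      z ^ 3 * σ (P.eval z) = A * (l1 * z + m1) ^ 3 + B * (l2 * z + m2) ^ 3 := by
    intro z hz
    rw [hcj z hz, hn0, hn1, hn2, hn3]; ring
  have hσa : σ a ≠ 0 := (map_ne_zero σ).2 ha
  have hσr : σ r ≠ 0 := (map_ne_zero σ).2 hr0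
  have hσD : σ l1 * σ m2 - σ l2 * σ m1 ≠ 0 := by
    rw [← map_mul, ← map_mul, ← map_sub]; exact (map_ne_zero σ).2 hD
  have hforms := linear_forms_of_cubes h3 hD (k1 := σ m1) (n1 := σ l1) (k2 := σ m2) (n2 := σ l2)
    (a := σ a) (b := -(σ a * σ r)) (A := A) (B := B)
    (by intro h; apply hσD; linear_combination -h)
    hσa (neg_ne_zero.2 (mul_ne_zero hσa hσr))
    (by rw [← hn0, hp3]; simp only [map_mul, map_sub, map_pow]; ring)
    (by rw [← hn1, hp2]; simp only [map_mul, map_sub, map_pow, map_ofNat]; ring)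
    (by rw [← hn2, hp1]; simp only [map_mul, map_sub, map_pow, map_ofNat]; ring)
    (by rw [← hn3, hp0]; simp only [map_mul, map_sub, map_pow]; ring)
  have hL : ∀ l m : F, l ≠ 0 ∨ m ≠ 0 → (C l * X + C m : F[X]) ≠ 0 := by
    rintro l m h h0
    have c0 := congrArg (fun P => coeff P 0) h0
    have c1 := congrArg (fun P => coeff P 1) h0
    simp [coeff_X, coeff_C] at c0 c1
    exact h.elim (fun h => h c1) (fun h => h c0)
  obtain ⟨w, hw, hwL⟩ := S.exists_unit_eval_ne_zero (f := (C l1 * X + C m1) * (C l2 * X + C m2))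
    (by
      refine mul_ne_zero (hL _ _ ?_) (hL _ _ ?_)
      · by_contra! h; apply hD; rw [h.1, h.2]; ring
      · by_contra! h; apply hD; rw [h.1, h.2]; ring)
    (le_trans (by compute_degree) ((by norm_num : 2 ≤ 5).trans S.five_le))
  obtain ⟨hW, hV⟩ : l1 * w + m1 ≠ 0 ∧ l2 * w + m2 ≠ 0 := by simpa using hwL
  have hww := map_eq_inv hw
  obtain ⟨Z1, hZ1⟩ : ∃ Z1, (l1 * m2 - l2 * m1) * Z1 = ω * (l1 * w + m1) * m2 - m1 * (l2 * w + m2) :=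
    ⟨_, mul_div_cancel₀ _ hD⟩
  obtain ⟨Z2, hZ2⟩ : ∃ Z2, (l1 * m2 - l2 * m1) * Z2 =
      l1 * (l2 * w + m2) - l2 * (ω * (l1 * w + m1)) :=
    ⟨_, mul_div_cancel₀ _ hD⟩
  have e1 : l1 * Z1 + m1 * Z2 = ω * (l1 * w + m1) := by
    apply mul_left_cancel₀ hD
    linear_combination l1 * hZ1 + m1 * hZ2
  have e2 : l2 * Z1 + m2 * Z2 = l2 * w + m2 := by
    apply mul_left_cancel₀ hD
    linear_combination l2 * hZ1 + m2 * hZ2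
  have hσZ1 := congrArg σ hZ1
  have hσZ2 := congrArg σ hZ2
  simp only [map_mul, map_sub, map_add] at hσZ1 hσZ2
  rcases hforms with ⟨x, y, f1, f2, f3, f4⟩ | ⟨x, y, f1, f2, f3, f4⟩
  · refine Or.inl ⟨fun hσω => ?_, x, y, f1, f2, f3, f4⟩
    rw [f1, f2, f3, f4] at hσD hσZ1 hσZ2
    rw [hσω] at hσZ1 hσZ2
    refine S.not_condition1_of_cubes (c := 1) hP hω3 hω1 hw hW hV e1 e2 ?_ ?_ hN hC
    · apply mul_left_cancel₀ hσD
      linear_combination (-x * y) * hZ1 - w * hσZ2 - x * y * m1 * m2 * (1 - ω) * hw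
    · apply mul_left_cancel₀ hσD
      linear_combination (-x * y) * hZ2 - w * hσZ1 - x * y * (ω * m1 * l2 - l1 * m2) * hw
  · refine Or.inr ⟨fun hσω => ?_, x, y, f1, f2, f3, f4⟩
    rw [f1, f2, f3, f4] at hσD hσZ1 hσZ2
    rw [hσω] at hσZ1 hσZ2
    refine S.not_condition1_of_cubes (c := ω) hP hω3 hω1 hw hW hV e1 e2 ?_ ?_ hN hC
    · apply mul_left_cancel₀ hσD
      linear_combination (x * y) * hZ1 - ω * w * hσZ2 - x * y * (ω - 1) * m1 * m2 * hw
        + x * y * (m1 * m2 * w * σ w + m1 * l2 * w) * hω3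
    · apply mul_left_cancel₀ hσD
      linear_combination (x * y) * hZ2 - ω * w * hσZ1 - x * y * (l1 * m2 - ω * l2 * m1) * hw
        - x * y * (l1 * l2 * w + l1 * m2 * w * σ w) * hω3

end QuadExt

theorem moebius3_C_mul {F : Type*} [Field F] (q : ℕ) (u v c : F) (P : F[X]) :
    moebius3 q u v (C c * P) = C c * moebius3 q u v P := by
  simp only [moebius3, coeff_C_mul, C_mul, Finset.mul_sum, mul_assoc]

theorem eq_cubic {F : Type*} [Field F] {P : F[X]} (hP : P.natDegree ≤ 3) :
    P = C (P.coeff 0) + C (P.coeff 1) * X + C (P.coeff 2) * X ^ 2 + C (P.coeff 3) * X ^ 3 := by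
  conv_lhs => rw [P.as_sum_range_C_mul_X_pow' (Nat.lt_succ_of_le hP)]
  simp [Finset.sum_range_succ]

theorem moebius3_cubic_expand {F : Type*} [Field F] (q : ℕ) (u v p0 p1 p2 p3 : F) :
    moebius3 q u v (C p0 + C p1 * X + C p2 * X ^ 2 + C p3 * X ^ 3) =
      C (p0 * u ^ 3 + p1 * v * u ^ 2 + p2 * v ^ 2 * u + p3 * v ^ 3)
      + C (3 * p0 * u ^ 2 * v ^ q + p1 * (u ^ q * u ^ 2 + 2 * v * u * v ^ q)
        + p2 * (2 * v * u ^ q * u + v ^ 2 * v ^ q) + 3 * p3 * v ^ 2 * u ^ q) * X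
      + C (3 * p0 * u * (v ^ q) ^ 2 + p1 * (v * (v ^ q) ^ 2 + 2 * u ^ q * u * v ^ q)
        + p2 * ((u ^ q) ^ 2 * u + 2 * v * u ^ q * v ^ q) + 3 * p3 * v * (u ^ q) ^ 2) * X ^ 2
      + C (p0 * (v ^ q) ^ 3 + p1 * u ^ q * (v ^ q) ^ 2 + p2 * (u ^ q) ^ 2 * v ^ q
        + p3 * (u ^ q) ^ 3) * X ^ 3 := by
  rw [moebius3_cubic]
  generalize u ^ q = U
  generalize v ^ q = V
  simp only [C_add, C_mul, C_pow, map_ofNat]; ring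

theorem moebius3_one {F : Type*} [Field F] {q : ℕ} {N : F} (hN : N ^ q = N) (hq : q ≠ 0) {P : F[X]}
    (hP : P.natDegree ≤ 3) : moebius3 q N 0 P = C (N ^ 3) * P := by
  conv_rhs => rw [eq_cubic hP]
  rw [eq_cubic hP, moebius3_cubic, hN, zero_pow hq, ← eq_cubic hP]
  simp only [C_0, C_pow]
  ring

theorem map_moebius3 {F : Type*} [Field F] {q : ℕ} (σ : F →+* F) (u v : F) (P : F[X]) :
    (moebius3 q u v P).map σ = moebius3 q (σ u) (σ v) (P.map σ) := by
  simp [moebius3, Polynomial.map_sum]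

theorem cubic_congr {F : Type*} [Field F] {p0 p1 p2 p3 n0 n1 n2 n3 : F} (h0 : p0 = n0)
    (h1 : p1 = n1) (h2 : p2 = n2) (h3 : p3 = n3) :
    C p0 + C p1 * X + C p2 * X ^ 2 + C p3 * X ^ 3
      = C n0 + C n1 * X + C n2 * X ^ 2 + C n3 * X ^ 3 := by
  rw [h0, h1, h2, h3]

namespace QuadExt

variable {F : Type*} [Field F] [Fintype F] {q : ℕ} {σ : F →+* F}

theorem moebius3_comp (S : QuadExt F q σ) (u v u' v' : F) {P : F[X]} (hP : P.natDegree ≤ 3) :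
    moebius3 q u v (moebius3 q u' v' P) =
      moebius3 q (u * u' + v * σ v') (v' * u + σ u' * v) P := by
  have hu : (u * u' + v * σ v') ^ q = σ u * σ u' + σ v * v' := by
    simp only [← S.pow, map_add, map_mul, S.invol]
  have hv : (v' * u + σ u' * v) ^ q = σ v' * σ u + u' * σ v := by
    simp only [← S.pow, map_add, map_mul, S.invol]
  rw [eq_cubic hP, moebius3_cubic_expand, moebius3_cubic_expand, moebius3_cubic_expand, hu, hv,
    ← S.pow, ← S.pow, ← S.pow, ← S.pow]
  generalize σ u = U
  generalize σ v = V
  generalize σ u' = U'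
  generalize σ v' = V'
  refine cubic_congr ?_ ?_ ?_ ?_ <;> ring

theorem sum_conj (S : QuadExt F q σ) (P : F[X]) :
    ∑ i ∈ Finset.range (P.natDegree + 1), C ((P.coeff i) ^ q) * X ^ i = P.map σ := by
  conv_rhs => rw [P.as_sum_range_C_mul_X_pow]
  simp [Polynomial.map_sum, S.pow]

theorem map_map_conj (S : QuadExt F q σ) (P : F[X]) : (P.map σ).map σ = P := by
  ext i; simp [S.invol]

theorem polEquiv_iff (S : QuadExt F q σ) {P Q : F[X]} :
    PolEquiv q P Q ↔ ∃ lam u v, lam ≠ 0 ∧ u * σ u ≠ v * σ v ∧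
      ∃ R, (R = P ∨ R = P.map σ) ∧ Q = C lam * moebius3 q u v R := by
  simp only [PolEquiv, S.sum_conj, S.pow_succ_eq, or_and_right, exists_or,
    exists_eq_left]

theorem polEquiv_symm (S : QuadExt F q σ) {P Q : F[X]} (hP : P.natDegree ≤ 3)
    (h : PolEquiv q P Q) : PolEquiv q Q P := by
  obtain ⟨lam, u, v, hlam, huv, R, hR, rfl⟩ := S.polEquiv_iff.1 h
  have hRd : R.natDegree ≤ 3 := by
    rcases hR with rfl | rfl
    · exact hP
    · exact natDegree_map_le.trans hP
  have hN0 : u * σ u - v * σ v ≠ 0 := sub_ne_zero.2 huv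
  have key : R = C (lam * (u * σ u - v * σ v) ^ 3)⁻¹ *
      moebius3 q (σ u) (-v) (C lam * moebius3 q u v R) := by
    have hN : (u * σ u - v * σ v) ^ q = u * σ u - v * σ v := by
      rw [← S.pow]; simp only [map_sub, map_mul, S.invol]; ring
    rw [moebius3_C_mul, S.moebius3_comp _ _ _ _ hRd]
    have e1 : σ u * u + -v * σ v = u * σ u - v * σ v := by ring
    have e2 : v * σ u + σ u * -v = 0 := by ring
    rw [e1, e2, moebius3_one hN (by have := S.five_le; omega) hRd, ← mul_assoc, ← mul_assoc,
      ← C_mul, ← C_mul, mul_assoc, inv_mul_cancel₀ (mul_ne_zero hlam (pow_ne_zero 3 hN0)), C_1,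
      one_mul]
  have hlam' : (lam * (u * σ u - v * σ v) ^ 3)⁻¹ ≠ 0 :=
    inv_ne_zero (mul_ne_zero hlam (pow_ne_zero 3 hN0))
  rw [S.polEquiv_iff]
  rcases hR with rfl | hR
  · refine ⟨_, σ u, -v, hlam', ?_, _, Or.inl rfl, key⟩
    rw [S.invol, map_neg, neg_mul_neg, mul_comm]; exact huv
  · refine ⟨σ (lam * (u * σ u - v * σ v) ^ 3)⁻¹, u, - σ v, (map_ne_zero σ).2 hlam', ?_, _,
      Or.inr rfl, ?_⟩
    · rw [map_neg, neg_mul_neg, S.invol, mul_comm (σ v)]; exact huv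
    · have := congrArg (Polynomial.map σ) key
      rw [Polynomial.map_mul, map_C, map_moebius3, S.invol, map_neg] at this
      rw [← this, hR, S.map_map_conj]

theorem polEquiv_trans (S : QuadExt F q σ) {P Q T : F[X]} (hP : P.natDegree ≤ 3)
    (h : PolEquiv q P Q) (h' : PolEquiv q Q T) : PolEquiv q P T := by
  obtain ⟨lam, u, v, hlam, huv, R, hR, rfl⟩ := S.polEquiv_iff.1 h
  obtain ⟨lam', u', v', hlam', huv', R', hR', rfl⟩ := S.polEquiv_iff.1 h'
  rw [S.polEquiv_iff]
  have hRd : R.natDegree ≤ 3 := by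
    rcases hR with rfl | rfl
    · exact hP
    · exact natDegree_map_le.trans hP
  rcases hR' with rfl | rfl
  · refine ⟨lam' * lam, u' * u + v' * σ v, v * u' + σ u * v', mul_ne_zero hlam' hlam, ?_, R, hR, ?_⟩
    rotate_left
    · rw [moebius3_C_mul, S.moebius3_comp _ _ _ _ hRd, C_mul, mul_assoc]
    · have h1 := sub_ne_zero.2 huv
      have h2 := sub_ne_zero.2 huv'
      rw [← sub_ne_zero]
      refine ne_of_eq_of_ne ?_ (mul_ne_zero h1 h2)
      simp only [map_add, map_mul, S.invol]; ring
  · refine ⟨lam' * σ lam, u' * σ u + v' * v, σ v * u' + u * v',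
      mul_ne_zero hlam' ((map_ne_zero σ).2 hlam), ?_, R.map σ, ?_, ?_⟩
    · have h1 := sub_ne_zero.2 huv
      have h2 := sub_ne_zero.2 huv'
      rw [← sub_ne_zero]
      refine ne_of_eq_of_ne ?_ (mul_ne_zero h1 h2)
      simp only [map_add, map_mul, S.invol]; ring
    · rcases hR with rfl | rfl
      · exact Or.inr rfl
      · exact Or.inl (S.map_map_conj P)
    · rw [Polynomial.map_mul, map_C, moebius3_C_mul, map_moebius3,
        S.moebius3_comp _ _ _ _ (natDegree_map_le.trans hRd), C_mul, mul_assoc, S.invol, S.invol]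

end QuadExt

/-- The monic combination of `(X - ω) ^ 3` and `(X - ω ^ 2) ^ 3` with ratio of coefficients `-r`. -/
def cubeCubic {F : Type*} [Field F] (ω r : F) : F[X] :=
  C (1 - r)⁻¹ * (C 1 * X + C (-ω)) ^ 3 + C (-(r * (1 - r)⁻¹)) * (C 1 * X + C (-ω ^ 2)) ^ 3

theorem cubeCubic_eq {F : Type*} [Field F] {ω r : F} (hω : ω ^ 2 + ω + 1 = 0) (hr : r ≠ 1) :
    ∃ δ, cubeCubic ω r = X ^ 3 - C δ * X ^ 2 - C (δ + 3) * X - 1 := by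
  have h : (1 - r) * (1 - r)⁻¹ = 1 := mul_inv_cancel₀ (sub_ne_zero.2 hr.symm)
  refine ⟨3 * (1 - r)⁻¹ * (ω - r * ω ^ 2), ?_⟩
  rw [cubeCubic, cubes_expand]
  generalize (1 - r)⁻¹ = A at *
  have e : (X ^ 3 - C (3 * A * (ω - r * ω ^ 2)) * X ^ 2
      - C (3 * A * (ω - r * ω ^ 2) + 3) * X - 1 : F[X]) =
      C (-1) + C (-(3 * A * (ω - r * ω ^ 2) + 3)) * X + C (-(3 * A * (ω - r * ω ^ 2))) * X ^ 2
        + C 1 * X ^ 3 := by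
    simp only [C_neg, C_1]; ring
  rw [e]
  have hω3 : ω ^ 3 = 1 := by linear_combination (ω - 1) * hω
  refine cubic_congr ?_ ?_ ?_ ?_
  · linear_combination (-1) * h + (-A + r * A * (ω ^ 3 + 1)) * hω3
  · linear_combination (-3) * h + 3 * A * hω - 3 * A * r * hω  - 3 * r * A * ω * hω3
  · ring
  · linear_combination h

theorem natDegree_cubeCubic_le {F : Type*} [Field F] (ω r : F) : (cubeCubic ω r).natDegree ≤ 3 := by
  rw [cubeCubic]
  compute_degree

theorem eval_cubeCubic {F : Type*} [Field F] (ω r z : F) :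
    (cubeCubic ω r).eval z = (1 - r)⁻¹ * ((z - ω) ^ 3 - r * (z - ω ^ 2) ^ 3) := by
  simp [cubeCubic]; ring

theorem cubeCubic_monic {F : Type*} [Field F] {ω r : F} (hω : ω ^ 2 + ω + 1 = 0) (hr : r ≠ 1) :
    (cubeCubic ω r).Monic ∧ (cubeCubic ω r).natDegree = 3 := by
  obtain ⟨δ, h⟩ := cubeCubic_eq hω hr
  have hd : (X ^ 3 - C δ * X ^ 2 - C (δ + 3) * X - 1 : F[X]).natDegree = 3 := by compute_degree!
  rw [h]
  exact ⟨by monicity!, hd⟩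

theorem cubeCubic_irreducible {F : Type*} [Field F] {ω r : F} (h3 : (3 : F) ≠ 0)
    (hω : ω ^ 2 + ω + 1 = 0) (hr : ∀ t, t ^ 3 ≠ r) : Irreducible (cubeCubic ω r) := by
  have hr1 : r ≠ 1 := fun h => hr 1 (by rw [h, one_pow])
  obtain ⟨hm, hd⟩ := cubeCubic_monic hω hr1
  rw [hm.irreducible_iff_roots_eq_zero_of_degree_le_three (by omega) (by omega)]
  refine Multiset.eq_zero_of_forall_notMem fun z hz => ?_
  have hz := (mem_roots'.1 hz).2
  rw [IsRoot.def, eval_cubeCubic] at hz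
  have hz := (mul_eq_zero.1 hz).resolve_left (inv_ne_zero (sub_ne_zero.2 hr1.symm))
  by_cases h : z - ω ^ 2 = 0
  · rw [h, sub_eq_zero.1 h] at hz
    apply h3
    have hω' : (ω ^ 2 - ω) ^ 3 = 0 := by linear_combination hz
    have := pow_eq_zero_iff (n := 3) (by norm_num) |>.1 hω'
    have hω1 : ω * (ω - 1) = 0 := by linear_combination this
    rcases mul_eq_zero.1 hω1 with h | h
    · rw [h] at hω; simp at hω
    · rw [sub_eq_zero.1 h] at hω; linear_combination hω
  · apply hr ((z - ω) / (z - ω ^ 2))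
    rw [div_pow, div_eq_iff (pow_ne_zero 3 h)]
    linear_combination hz

/-- `ω` is a primitive cube root of unity, and `k` is the one among `q - 1` and `q + 1` which is
prime to three, while `n` is the other one. -/
structure CubicCase {F : Type*} [Field F] (q : ℕ) (σ : F →+* F) (ω : F) (k n : ℕ) : Prop where
  root : ω ^ 2 + ω + 1 = 0
  mul_eq : q ^ 2 - 1 = k * n
  dvd : 6 ∣ n
  bezout : ∃ m j, 3 * m = k * j + 1
  cases : (σ ω = ω ∧ k = q + 1) ∨ (σ ω = ω ^ 2 ∧ k + 1 = q)

namespace CubicCase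

variable {F : Type*} [Field F] {q : ℕ} {σ : F →+* F} {ω : F} {k n : ℕ}

theorem pow_three (T : CubicCase q σ ω k n) : ω ^ 3 = 1 := by
  linear_combination (ω - 1) * T.root

theorem ne_zero (T : CubicCase q σ ω k n) : ω ≠ 0 := by
  rintro rfl; simpa using T.root

theorem exists_cube_root (T : CubicCase q σ ω k n) {s : F} (hs : s ^ k = 1) :
    ∃ t, t ^ 3 = s ∧ t ^ k = 1 := by
  obtain ⟨m, j, h⟩ := T.bezout
  refine ⟨s ^ m, ?_, ?_⟩
  · rw [← pow_mul, mul_comm, h, pow_succ, pow_mul, hs, one_pow, one_mul]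
  · rw [← pow_mul, mul_comm, pow_mul, hs, one_pow]

theorem pow_ne_one (T : CubicCase q σ ω k n) {r : F}
    (hr : ∀ t, t ^ 3 ≠ r) : r ^ k ≠ 1 := by
  intro h
  obtain ⟨t, ht, -⟩ := T.exists_cube_root h
  exact hr t ht

variable [Fintype F]

theorem pow_eq_one_iff (T : CubicCase q σ ω k n) (S : QuadExt F q σ) {t : F} (ht : t ≠ 0) :
    t ^ k = 1 ↔ (σ ω = ω ∧ t * σ t = 1) ∨ (σ ω = ω ^ 2 ∧ σ t = t) := by
  have h1 : σ ω = ω → σ ω = ω ^ 2 → False := by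
    intro h h'
    have h0 : ω * (ω - 1) = 0 := by linear_combination h - h'
    have hω := T.root
    rcases mul_eq_zero.1 h0 with h | h
    · rw [h] at hω; simp at hω
    · rw [sub_eq_zero.1 h] at hω; exact S.three_ne (by linear_combination hω)
  rcases T.cases with ⟨hσ, rfl⟩ | ⟨hσ, hk⟩
  · rw [S.pow_succ_eq]
    exact ⟨fun h => Or.inl ⟨hσ, h⟩, fun h => h.elim (fun h => h.2) fun h => (h1 hσ h.1).elim⟩
  · have : t ^ k = 1 ↔ σ t = t := by
      rw [S.pow, ← hk, pow_succ]
      constructor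
      · intro h; rw [h, one_mul]
      · intro h; apply mul_right_cancel₀ ht; rw [h, one_mul]
    rw [this]
    exact ⟨fun h => Or.inr ⟨hσ, h⟩, fun h => h.elim (fun h => (h1 h.1 hσ).elim) fun h => h.2⟩

end CubicCase

namespace QuadExt

variable {F : Type*} [Field F] [Fintype F] {q : ℕ} {σ : F →+* F}

theorem polEquiv_cubeCubic_of_forms (S : QuadExt F q σ) {ω : F} (hω : ω ^ 2 + ω + 1 = 0)
    {a b l1 m1 l2 m2 u v e1 e2 r : F} (ha : a ≠ 0) (he1 : e1 ≠ 0) (he2 : e2 ≠ 0)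
    (h1 : l1 * σ u + m1 * σ v = e1) (h1' : l1 * v + m1 * u = -ω * e1)
    (h2 : l2 * σ u + m2 * σ v = e2) (h2' : l2 * v + m2 * u = -ω ^ 2 * e2)
    (hr : r ≠ 1) (hab : b * e2 ^ 3 = -(r * (a * e1 ^ 3))) :
    PolEquiv q (C a * (C l1 * X + C m1) ^ 3 + C b * (C l2 * X + C m2) ^ 3) (cubeCubic ω r) := by
  have hr1 : 1 - r ≠ 0 := sub_ne_zero.2 hr.symm
  have hlam : a * e1 ^ 3 * (1 - r) ≠ 0 := mul_ne_zero (mul_ne_zero ha (pow_ne_zero 3 he1)) hr1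
  rw [S.polEquiv_iff]
  refine ⟨(a * e1 ^ 3 * (1 - r))⁻¹, u, v, inv_ne_zero hlam, ?_, _, Or.inl rfl, ?_⟩
  · intro h
    have h0 : e1 * (-ω ^ 2 * e2) - e2 * (-ω * e1) = 0 := by
      rw [← h2', ← h1', ← h1, ← h2]
      linear_combination (l1 * m2 - l2 * m1) * h
    have hz : e1 * e2 * (ω * (ω - 1)) = 0 := by linear_combination -h0
    rcases mul_eq_zero.1 ((mul_eq_zero.1 hz).resolve_left (mul_ne_zero he1 he2)) with h | h
    · rw [h] at hω; simp at hω
    · rw [sub_eq_zero.1 h] at hω; exact S.three_ne (by linear_combination hω)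
  · rw [moebius3_cubes, ← S.pow, ← S.pow, h1, h1', h2, h2', cubeCubic]
    have k1 : (1 - r)⁻¹ = (a * e1 ^ 3 * (1 - r))⁻¹ * a * e1 ^ 3 := by field_simp
    have k2 : -(r * (1 - r)⁻¹) = (a * e1 ^ 3 * (1 - r))⁻¹ * b * e2 ^ 3 := by
      rw [mul_assoc, hab]; field_simp
    rw [k2, k1]
    simp only [C_mul, C_pow, C_neg, C_1]
    ring

end QuadExt

namespace CubicCase

variable {F : Type*} [Field F] [Fintype F] {q : ℕ} {σ : F →+* F} {ω : F} {k n : ℕ}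

theorem sq_ne (T : CubicCase q σ ω k n) (S : QuadExt F q σ) : ω ^ 2 ≠ ω := by
  intro h
  have hω := T.root
  rcases mul_eq_zero.1 (show ω * (ω - 1) = 0 by linear_combination h) with h | h
  · rw [h] at hω; simp at hω
  · rw [sub_eq_zero.1 h] at hω; exact S.three_ne (by linear_combination hω)

/-- Every good cubic is equivalent to one in normal form. -/
theorem exists_polEquiv_cubeCubic (T : CubicCase q σ ω k n) (S : QuadExt F q σ) {P : F[X]}
    (hP : Good q P) : ∃ r, (∀ t, t ^ 3 ≠ r) ∧ PolEquiv q P (cubeCubic ω r) := by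
  have hω := T.root
  have hω3 := T.pow_three
  have hω0 := T.ne_zero
  obtain ⟨l1, m1, l2, m2, a, r, hD, ha, hr, hP, hcase⟩ := S.exists_cubes_of_good hω hP
  have key : ∀ e1 e2 s1 s2 u v, e1 ≠ 0 → e2 ≠ 0 → s1 = -ω * e1 → s2 = -ω ^ 2 * e2 →
      l1 * v + m1 * u = s1 → l2 * v + m2 * u = s2 → l1 * σ u + m1 * σ v = e1 →
      l2 * σ u + m2 * σ v = e2 → ∃ r, (∀ t, t ^ 3 ≠ r) ∧ PolEquiv q P (cubeCubic ω r) := by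
    intro e1 e2 s1 s2 u v he1 he2 hs1 hs2 h1' h2' h1 h2
    have hr' : ∀ t, t ^ 3 ≠ r * (e2 / e1) ^ 3 := by
      intro t ht
      apply hr (t * (e1 / e2))
      rw [mul_pow, ht]
      field_simp
    have hP' : P = C a * (C l1 * X + C m1) ^ 3 + C (-(a * r)) * (C l2 * X + C m2) ^ 3 := by
      rw [hP, C_neg, C_mul]; ring
    refine ⟨_, hr', ?_⟩
    rw [hP']
    refine S.polEquiv_cubeCubic_of_forms hω ha he1 he2 h1 (h1'.trans hs1) h2 (h2'.trans hs2)
      (fun h => hr' 1 (by rw [h, one_pow])) ?_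
    field_simp
  have solve : ∀ s1 s2, ∃ u v, l1 * v + m1 * u = s1 ∧ l2 * v + m2 * u = s2 := fun s1 s2 =>
    ⟨(l1 * s2 - l2 * s1) / (l1 * m2 - l2 * m1), (s1 * m2 - s2 * m1) / (l1 * m2 - l2 * m1),
      by rw [mul_div_assoc', mul_div_assoc', ← add_div, div_eq_iff hD]; ring,
      by rw [mul_div_assoc', mul_div_assoc', ← add_div, div_eq_iff hD]; ring⟩
  have h1ne : l1 ≠ 0 ∨ m1 ≠ 0 := by
    by_contra! h; apply hD; rw [h.1, h.2]; ring
  have h2ne : l2 ≠ 0 ∨ m2 ≠ 0 := by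
    by_contra! h; apply hD; rw [h.1, h.2]; ring
  have one_of : ∀ {c l m : F}, l ≠ 0 ∨ m ≠ 0 → l = c * l → m = c * m → c = 1 := by
    rintro c l m (h | h) hl hm
    · exact mul_right_cancel₀ h (by rw [← hl, one_mul])
    · exact mul_right_cancel₀ h (by rw [← hm, one_mul])
  have twice : ∀ {a b c d e : F}, σ a = b * c → σ c = d * e → a = σ b * d * e := by
    intro a b c d e h h'
    rw [← S.invol a, h, map_mul, h', mul_assoc]
  rcases hcase with ⟨hσ, x, y, f1, f2, f3, f4⟩ | ⟨hσ, x, y, f1, f2, f3, f4⟩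
  · have hσω : σ ω = ω ^ 2 := by
      rcases T.cases with h | h
      · exact (hσ h.1).elim
      · exact h.1
    have hx : σ x * x = 1 := one_of h1ne
      (twice f2 f1) (twice f1 f2)
    have hy : σ y * y = 1 := one_of h2ne
      (twice f4 f3) (twice f3 f4)
    obtain ⟨s1, hs1, k1⟩ := S.exists_map_eq_mul (c := -ω ^ 2 * x) (by
      rw [map_mul, map_neg, map_pow, hσω]
      linear_combination ω ^ 6 * hx + (ω ^ 3 + 1) * hω3)
    obtain ⟨s2, hs2, k2⟩ := S.exists_map_eq_mul (c := -ω * y) (by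
      rw [map_mul, map_neg, hσω]
      linear_combination ω ^ 3 * hy + hω3)
    obtain ⟨u, v, h1', h2'⟩ := solve s1 s2
    have h1 : l1 * σ u + m1 * σ v = σ x * σ s1 := by
      rw [← h1', ← map_mul, ← S.invol (l1 * σ u + m1 * σ v)]
      congr 1
      simp only [map_add, map_mul, S.invol, f1, f2]; ring
    have h2 : l2 * σ u + m2 * σ v = σ y * σ s2 := by
      rw [← h2', ← map_mul, ← S.invol (l2 * σ u + m2 * σ v)]
      congr 1
      simp only [map_add, map_mul, S.invol, f3, f4]; ring
    refine key _ _ s1 s2 u v ?_ ?_ ?_ ?_ h1' h2' h1 h2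
    · exact mul_ne_zero (left_ne_zero_of_mul_eq_one hx) ((map_ne_zero σ).2 hs1)
    · exact mul_ne_zero (left_ne_zero_of_mul_eq_one hy) ((map_ne_zero σ).2 hs2)
    · rw [k1]; linear_combination (-ω ^ 3 * s1) * hx - s1 * hω3
    · rw [k2]; linear_combination (-ω ^ 3 * s2) * hy - s2 * hω3
  · have hσω : σ ω = ω := by
      rcases T.cases with h | h
      · exact h.1
      · exact (hσ h.1).elim
    have hx : σ x * y = 1 := one_of h1ne
      (twice f2 f3) (twice f1 f4)
    have hy : σ y * x = 1 := by
      rw [← S.invol x, ← map_mul, mul_comm, hx, map_one]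
    obtain ⟨u, v, h1', h2'⟩ := solve (-ω * σ x) 1
    have h1 : l1 * σ u + m1 * σ v = σ x := by
      rw [← mul_one x, ← h2', ← S.invol (l1 * σ u + m1 * σ v)]
      congr 1
      simp only [map_add, map_mul, S.invol, f1, f2]; ring
    have h2 : l2 * σ u + m2 * σ v = -ω := by
      rw [← S.invol (l2 * σ u + m2 * σ v), ← S.invol (-ω)]
      congr 1
      simp only [map_add, map_mul, map_neg, S.invol, f3, f4, hσω]
      linear_combination y * h1' - ω * hx
    refine key _ _ _ _ u v ?_ ?_ rfl ?_ h1' h2' h1 h2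
    · exact left_ne_zero_of_mul_eq_one hx
    · exact neg_ne_zero.2 hω0
    · linear_combination -hω3

end CubicCase

namespace CubicCase

variable {F : Type*} [Field F] {q : ℕ} {σ : F →+* F} {ω : F} {k n : ℕ}

theorem eq_of_cubes_eq (T : CubicCase q σ ω k n) {x y : F} (h : x ^ 3 = y ^ 3) :
    ∃ ζ, x = ζ * y ∧ (ζ = 1 ∨ ζ = ω ∨ ζ = ω ^ 2) := by
  have hp : (x - y) * ((x - ω * y) * (x - ω ^ 2 * y)) = 0 := by
    linear_combination h + (-x ^ 2 * y + x * y ^ 2 * ω) * T.root - y ^ 3 * T.pow_three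
  rcases mul_eq_zero.1 hp with h | h
  · exact ⟨1, by linear_combination h, Or.inl rfl⟩
  · rcases mul_eq_zero.1 h with h | h
    · exact ⟨ω, by linear_combination h, Or.inr (Or.inl rfl)⟩
    · exact ⟨ω ^ 2, by linear_combination h, Or.inr (Or.inr rfl)⟩

variable [Fintype F]

theorem ne_one (T : CubicCase q σ ω k n) (S : QuadExt F q σ) : ω ≠ 1 := by
  rintro rfl; exact T.sq_ne S (one_pow 2)

theorem condition1_cubeCubic (T : CubicCase q σ ω k n) (S : QuadExt F q σ) {r : F}
    (hr : ∀ t, t ^ 3 ≠ r) : Condition1 q 3 (cubeCubic ω r) := by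
  rw [S.condition1_iff]
  intro z w hz hw h
  have hω3 := T.pow_three
  have hω0 := T.ne_zero
  have hω1 := T.ne_one S
  have hω2 := T.sq_ne S
  have hr0 : r ≠ 0 := fun h => hr 0 (by rw [h]; simp)
  have hr1 : r ≠ 1 := fun h => hr 1 (by rw [h, one_pow])
  have hrk := T.pow_ne_one hr
  rw [Ne, T.pow_eq_one_iff S hr0] at hrk
  obtain ⟨A, hA⟩ : ∃ A, A = z - ω := ⟨_, rfl⟩
  obtain ⟨B, hB⟩ : ∃ B, B = z - ω ^ 2 := ⟨_, rfl⟩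
  obtain ⟨A', hA'⟩ : ∃ A, A = w - ω := ⟨_, rfl⟩
  obtain ⟨B', hB'⟩ : ∃ B, B = w - ω ^ 2 := ⟨_, rfl⟩
  have ha : (1 - r)⁻¹ ≠ 0 := inv_ne_zero (sub_ne_zero.2 hr1.symm)
  have hσa : σ (1 - r)⁻¹ ≠ 0 := (map_ne_zero σ).2 ha
  have hz0 := QuadExt.ne_zero_of_unit hz
  have hw0 := QuadExt.ne_zero_of_unit hw
  have hfin : A * B' = B * A' → z = w := by
    intro h
    rw [hA, hB, hA', hB'] at h
    apply mul_left_cancel₀ (sub_ne_zero.2 hω2)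
    linear_combination -h
  have hzero : A * B' = 0 → B * A' = 0 → z = w := fun h1 h2 => hfin (h1.trans h2.symm)
  rw [eval_cubeCubic, eval_cubeCubic, ← hA, ← hB, ← hA', ← hB'] at h
  simp only [map_mul, map_sub σ (_ ^ 3), map_pow] at h
  rcases T.cases with ⟨hσ, -⟩ | ⟨hσ, -⟩
  · have sA : z * σ A = -ω * B := by
      rw [hA, hB, map_sub, hσ]; linear_combination hz - hω3
    have sB : z * σ B = -ω ^ 2 * A := by
      rw [hA, hB, map_sub, map_pow, hσ]; linear_combination hz - hω3
    have sA' : w * σ A' = -ω * B' := by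
      rw [hA', hB', map_sub, hσ]; linear_combination hw - hω3
    have sB' : w * σ B' = -ω ^ 2 * A' := by
      rw [hA', hB', map_sub, map_pow, hσ]; linear_combination hw - hω3
    have hcube : (A * B') ^ 3 = (B * A') ^ 3 := by
      have cA : z ^ 3 * σ A ^ 3 = -B ^ 3 := by
        rw [← mul_pow, sA]; linear_combination -B ^ 3 * hω3
      have cB : z ^ 3 * σ B ^ 3 = -A ^ 3 := by
        rw [← mul_pow, sB]; linear_combination -A ^ 3 * (ω ^ 3 + 1) * hω3
      have cA' : w ^ 3 * σ A' ^ 3 = -B' ^ 3 := by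
        rw [← mul_pow, sA']; linear_combination -B' ^ 3 * hω3
      have cB' : w ^ 3 * σ B' ^ 3 = -A' ^ 3 := by
        rw [← mul_pow, sB']; linear_combination -A' ^ 3 * (ω ^ 3 + 1) * hω3
      have hrr : r * σ r - 1 ≠ 0 := sub_ne_zero.2 fun h => hrk (Or.inl ⟨hσ, h⟩)
      apply mul_left_cancel₀ hrr
      apply mul_left_cancel₀ (mul_ne_zero ha hσa)
      linear_combination h - (1 - r)⁻¹ * σ (1 - r)⁻¹ * (A ^ 3 - r * B ^ 3) * (cA' - σ r * cB')
        + (1 - r)⁻¹ * σ (1 - r)⁻¹ * (A' ^ 3 - r * B' ^ 3) * (cA - σ r * cB)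
    obtain ⟨ζ, hζ, hζ'⟩ := T.eq_of_cubes_eq hcube
    have hσζ : σ ζ = ζ := by
      rcases hζ' with rfl | rfl | rfl <;> simp [hσ]
    have h2 : B * A' = ζ * (A * B') := by
      have := congrArg (fun t => z * w * σ t) hζ
      simp only [map_mul, hσζ] at this
      linear_combination this - w * σ B' * sA + ω * B * sB' + ζ * (w * σ A' * sB - ω ^ 2 * A * sA')
        + (ζ * A * B' - B * A') * hω3
    by_cases h0 : B * A' = 0
    · exact hzero (by rw [hζ, h0, mul_zero]) h0
    · have hζ2 : ζ ^ 2 = 1 := by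
        apply mul_right_cancel₀ h0
        linear_combination -h2 - ζ * hζ
      rcases hζ' with rfl | h | rfl
      · exact hfin (by rw [hζ, one_mul])
      · rw [h] at hζ2
        exact (hω1 (by linear_combination hω3 - ω * hζ2)).elim
      · exact (hω1 (by linear_combination hζ2 - ω * hω3)).elim
  · have sA : z * σ A = -ω ^ 2 * A := by
      rw [hA, map_sub, hσ]; linear_combination hz - hω3
    have sB : z * σ B = -ω * B := by
      rw [hB, map_sub, map_pow, hσ]; linear_combination hz - (ω * z + 1) * hω3
    have sA' : w * σ A' = -ω ^ 2 * A' := by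
      rw [hA', map_sub, hσ]; linear_combination hw - hω3
    have sB' : w * σ B' = -ω * B' := by
      rw [hB', map_sub, map_pow, hσ]; linear_combination hw - (ω * w + 1) * hω3
    have hcube : (A * B') ^ 3 = (B * A') ^ 3 := by
      have cA : z ^ 3 * σ A ^ 3 = -A ^ 3 := by
        rw [← mul_pow, sA]; linear_combination -A ^ 3 * (ω ^ 3 + 1) * hω3
      have cB : z ^ 3 * σ B ^ 3 = -B ^ 3 := by
        rw [← mul_pow, sB]; linear_combination -B ^ 3 * hω3
      have cA' : w ^ 3 * σ A' ^ 3 = -A' ^ 3 := by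
        rw [← mul_pow, sA']; linear_combination -A' ^ 3 * (ω ^ 3 + 1) * hω3
      have cB' : w ^ 3 * σ B' ^ 3 = -B' ^ 3 := by
        rw [← mul_pow, sB']; linear_combination -B' ^ 3 * hω3
      have hrr : σ r - r ≠ 0 := sub_ne_zero.2 fun h => hrk (Or.inr ⟨hσ, h⟩)
      apply mul_left_cancel₀ hrr
      apply mul_left_cancel₀ (mul_ne_zero ha hσa)
      linear_combination h - (1 - r)⁻¹ * σ (1 - r)⁻¹ * (A ^ 3 - r * B ^ 3) * (cA' - σ r * cB')
        + (1 - r)⁻¹ * σ (1 - r)⁻¹ * (A' ^ 3 - r * B' ^ 3) * (cA - σ r * cB)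
    obtain ⟨ζ, hζ, hζ'⟩ := T.eq_of_cubes_eq hcube
    have hσζ : σ ζ = ζ ^ 2 := by
      rcases hζ' with rfl | rfl | rfl <;> simp [hσ]
    have h2 : A * B' = ζ ^ 2 * (B * A') := by
      have := congrArg (fun t => z * w * σ t) hζ
      simp only [map_mul, hσζ] at this
      linear_combination this - w * σ B' * sA + ω ^ 2 * A * sB'
        + ζ ^ 2 * (w * σ A' * sB - ω * B * sA') + (ζ ^ 2 * B * A' - A * B') * hω3
    by_cases h0 : B * A' = 0
    · exact hzero (by rw [hζ, h0, mul_zero]) h0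
    · have hζ2 : ζ ^ 2 = ζ := by
        apply mul_right_cancel₀ h0
        rw [← h2, hζ]
      rcases hζ' with rfl | rfl | rfl
      · exact hfin (by rw [hζ, one_mul])
      · exact (hω2 hζ2).elim
      · exact (hω2 (by linear_combination -hζ2 + ω * hω3)).elim

theorem good_cubeCubic (T : CubicCase q σ ω k n) (S : QuadExt F q σ) {r : F}
    (hr : ∀ t, t ^ 3 ≠ r) : Good q (cubeCubic ω r) := by
  have hr1 : r ≠ 1 := fun h => hr 1 (by rw [h, one_pow])
  obtain ⟨hm, hd⟩ := cubeCubic_monic T.root hr1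
  exact ⟨hm, hd, cubeCubic_irreducible S.three_ne T.root hr, T.condition1_cubeCubic S hr⟩

end CubicCase

theorem cubeCubic_inv {F : Type*} [Field F] (ω : F) {r : F} (h0 : r ≠ 0) (h1 : r ≠ 1) :
    cubeCubic ω r⁻¹ =
      C (-(r * (1 - r)⁻¹)) * (C 1 * X + C (-ω)) ^ 3 + C (1 - r)⁻¹ * (C 1 * X + C (-ω ^ 2)) ^ 3 := by
  have h1' : 1 - r ≠ 0 := sub_ne_zero.2 h1.symm
  have h2' : r - 1 ≠ 0 := sub_ne_zero.2 h1
  have e : 1 - r⁻¹ = -(1 - r) * r⁻¹ := by field_simp; ring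
  have e1 : (1 - r⁻¹)⁻¹ = -(r * (1 - r)⁻¹) := by
    rw [e, mul_inv, inv_inv, inv_neg]; ring
  have e2 : -(r⁻¹ * (1 - r⁻¹)⁻¹) = (1 - r)⁻¹ := by
    rw [e1]; field_simp
  rw [cubeCubic, e2, e1]

namespace CubicCase

variable {F : Type*} [Field F] [Fintype F] {q : ℕ} {σ : F →+* F} {ω : F} {k n : ℕ}

theorem exists_map_cubeCubic (T : CubicCase q σ ω k n) (S : QuadExt F q σ) {r : F}
    (hr : ∀ t, t ^ 3 ≠ r) :
    ∃ s, (∀ t, t ^ 3 ≠ s) ∧ (cubeCubic ω r).map σ = cubeCubic ω s ∧ s ^ k = r ^ k := by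
  have hr0 : r ≠ 0 := fun h => hr 0 (by rw [h]; simp)
  have hr1 : r ≠ 1 := fun h => hr 1 (by rw [h, one_pow])
  have hσ0 : σ r ≠ 0 := (map_ne_zero σ).2 hr0
  have hσ1 : σ r ≠ 1 := fun h => hr1 (σ.injective (by rw [h, map_one]))
  have hσr : ∀ t, t ^ 3 ≠ σ r := fun t h => hr (σ t) (by rw [← map_pow, h, S.invol])
  have hω3 := T.pow_three
  rcases T.cases with ⟨hσ, hk⟩ | ⟨hσ, hk⟩
  · refine ⟨σ r, hσr, ?_, ?_⟩
    · simp [cubeCubic, hσ]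
    · rw [hk, S.pow_succ_eq, S.pow_succ_eq, S.invol, mul_comm]
  · refine ⟨(σ r)⁻¹, fun t h => hσr t⁻¹ (by rw [inv_pow, h, inv_inv]), ?_, ?_⟩
    · have h4 : (ω ^ 2) ^ 2 = ω := by linear_combination ω * hω3
      have h5 : (C ω ^ 2 : F[X]) ^ 2 = C ω := by rw [← C_pow, ← C_pow, h4]
      rw [cubeCubic_inv ω hσ0 hσ1, add_comm]
      simp [cubeCubic, hσ, h5]
    · have := (T.pow_eq_one_iff S (mul_ne_zero hr0 hσ0)).2
        (Or.inr ⟨hσ, by rw [map_mul, S.invol, mul_comm]⟩)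
      rw [mul_pow] at this
      rw [inv_pow]
      exact (eq_inv_of_mul_eq_one_left this).symm

theorem pow_eq_of_moebius3 (T : CubicCase q σ ω k n) (S : QuadExt F q σ) {r s lam u v : F}
    (hr : ∀ t, t ^ 3 ≠ r) (hs : ∀ t, t ^ 3 ≠ s) (hlam : lam ≠ 0) (huv : u * σ u ≠ v * σ v)
    (h : cubeCubic ω s = C lam * moebius3 q u v (cubeCubic ω r)) :
    s ^ k = r ^ k ∨ s ^ k * r ^ k = 1 := by
  have hr0 : r ≠ 0 := fun h => hr 0 (by rw [h]; simp)
  have hr1 : 1 - r ≠ 0 := fun h => hr 1 (by linear_combination h)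
  have hs0 : s ≠ 0 := fun h => hs 0 (by rw [h]; simp)
  have hs1 : 1 - s ≠ 0 := fun h => hs 1 (by linear_combination h)
  have hω3 := T.pow_three
  have hω0 := T.ne_zero
  have hd : ω - ω ^ 2 ≠ 0 := sub_ne_zero.2 (T.sq_ne S).symm
  have h3 := S.three_ne
  obtain ⟨A, hA⟩ : ∃ A, A = lam * (1 - r)⁻¹ := ⟨_, rfl⟩
  obtain ⟨A', hA'⟩ : ∃ A, A = (1 - s)⁻¹ := ⟨_, rfl⟩
  have hA0 : A ≠ 0 := by rw [hA]; exact mul_ne_zero hlam (inv_ne_zero hr1)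
  have hA'0 : A' ≠ 0 := by rw [hA']; exact inv_ne_zero hs1
  have hC : C lam * moebius3 q u v (cubeCubic ω r) =
      C A * (C (1 * σ u + -ω * σ v) * X + C (1 * v + -ω * u)) ^ 3
      + C (-(r * A)) * (C (1 * σ u + -ω ^ 2 * σ v) * X + C (1 * v + -ω ^ 2 * u)) ^ 3 := by
    have e : -(r * (lam * (1 - r)⁻¹)) = lam * -(r * (1 - r)⁻¹) := by ring
    rw [cubeCubic, moebius3_cubes, ← S.pow, ← S.pow, hA, e, mul_add, ← mul_assoc, ← mul_assoc,
      ← C_mul, ← C_mul]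
  rw [hC, cubeCubic, ← hA', cubes_expand, cubes_expand] at h
  obtain ⟨E0, E1, E2, E3⟩ := cubic_coeffs_inj h
  have hforms := linear_forms_of_cubes h3 (by simpa [sub_eq_add_neg, add_comm] using hd)
    (fun h => huv (mul_left_cancel₀ hd (by linear_combination h))) hA0
    (neg_ne_zero.2 (mul_ne_zero hr0 hA0)) E0.symm E1.symm E2.symm E3.symm
  have pow_of : ∀ {a b : F}, a ≠ 0 → b ≠ 0 →
      ((σ ω = ω ∧ a * σ a = b * σ b) ∨ (σ ω = ω ^ 2 ∧ σ a * b = a * σ b)) → a ^ k = b ^ k := by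
    intro a b ha hb hab
    have hσb : σ b ≠ 0 := (map_ne_zero σ).2 hb
    have := (T.pow_eq_one_iff S (div_ne_zero ha hb)).2 (by
      rcases hab with ⟨h, h'⟩ | ⟨h, h'⟩
      · refine Or.inl ⟨h, ?_⟩
        rw [map_div₀, div_mul_div_comm, h', div_self (mul_ne_zero hb hσb)]
      · refine Or.inr ⟨h, ?_⟩
        rw [map_div₀, div_eq_div_iff hσb hb, h'])
    rw [div_pow] at this
    exact eq_of_div_eq_one this
  rcases hforms with ⟨x, y, f1, f2, f3, f4⟩ | ⟨x, y, f1, f2, f3, f4⟩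
  · simp only [f1, f2, f3, f4] at E2 E3
    have g2 := congrArg σ f2
    have g4 := congrArg σ f4
    simp only [map_add, map_mul, map_neg, map_pow, map_one] at g2 g4
    have k1 : A * x ^ 3 = A' := by
      apply mul_left_cancel₀ (mul_ne_zero h3 hd)
      linear_combination E2 + 3 * ω ^ 2 * E3
    have k2 : r * y ^ 3 = s * x ^ 3 := by
      apply mul_left_cancel₀ hA0
      linear_combination E3 + (1 - s) * k1
    have hx : x ≠ 0 := by rintro rfl; exact hA'0 (by rw [← k1]; ring)
    have hy : y ≠ 0 := by
      rintro rfl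
      exact mul_ne_zero hs0 (pow_ne_zero 3 hx) (by rw [← k2]; ring)
    have hxy : (y ^ 3) ^ k = (x ^ 3) ^ k := by
      refine pow_of (pow_ne_zero 3 hy) (pow_ne_zero 3 hx) ?_
      rcases T.cases with ⟨hσ, -⟩ | ⟨hσ, -⟩
      · refine Or.inl ⟨hσ, ?_⟩
        rw [hσ] at g2 g4
        have e1 : σ y = x := by
          apply mul_left_cancel₀ (pow_ne_zero 2 hω0)
          linear_combination g4 + ω ^ 2 * f1 + σ v * hω3
        rw [map_pow, map_pow, e1, ← e1, S.invol]; ring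
      · refine Or.inr ⟨hσ, ?_⟩
        rw [hσ] at g2 g4
        have e1 : σ x = x := by
          apply mul_left_cancel₀ (pow_ne_zero 2 hω0)
          linear_combination g2 + ω ^ 2 * f1 + σ v * hω3
        have e2 : σ y = y := by
          apply mul_left_cancel₀ hω0
          linear_combination g4 + ω * f3 + (σ v + ω * σ u - ω * σ y) * hω3
        rw [map_pow, map_pow, e1, e2, mul_comm]
    left
    apply mul_right_cancel₀ (pow_ne_zero k (pow_ne_zero 3 hx))
    rw [← mul_pow, ← k2, mul_pow, hxy]
  · simp only [f1, f2, f3, f4] at E2 E3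
    have g2 := congrArg σ f2
    have g4 := congrArg σ f4
    simp only [map_add, map_mul, map_neg, map_pow, map_one] at g2 g4
    have k1 : A * x ^ 3 = -(s * A') := by
      apply mul_left_cancel₀ (mul_ne_zero h3 hd)
      linear_combination -E2 - 3 * ω * E3
    have k2 : s * (r * y ^ 3) = x ^ 3 := by
      apply mul_left_cancel₀ hA0
      linear_combination s * E3 + (s - 1) * k1
    have hx : x ≠ 0 := by
      rintro rfl
      exact mul_ne_zero hs0 hA'0 (by linear_combination k1)
    have hy : y ≠ 0 := by
      rintro rfl
      exact pow_ne_zero 3 hx (by rw [← k2]; ring)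
    have hxy : (x ^ 3) ^ k = (y ^ 3) ^ k := by
      refine pow_of (pow_ne_zero 3 hx) (pow_ne_zero 3 hy) ?_
      rcases T.cases with ⟨hσ, -⟩ | ⟨hσ, -⟩
      · refine Or.inl ⟨hσ, ?_⟩
        rw [hσ] at g2 g4
        have e1 : σ y = ω * x := by
          apply mul_left_cancel₀ hω0
          linear_combination g4 + ω ^ 2 * f1 + σ v * hω3
        have e2 : σ x = ω ^ 2 * y := by
          have := congrArg σ e1
          rw [S.invol, map_mul, hσ] at this
          linear_combination -ω ^ 2 * this - σ x * hω3
        rw [map_pow, map_pow, e1, e2]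
        linear_combination x ^ 3 * y ^ 3 * ω ^ 3 * hω3
      · refine Or.inr ⟨hσ, ?_⟩
        rw [hσ] at g2 g4
        have e1 : σ x = ω * x := by
          apply mul_left_cancel₀ hω0
          linear_combination g2 + ω ^ 2 * f1 + (σ v - ω * σ x) * hω3
        have e2 : σ y = ω ^ 2 * y := by
          apply mul_left_cancel₀ (pow_ne_zero 2 hω0)
          linear_combination g4 + ω * f3 + (σ v + ω * σ u - ω * y) * hω3
        rw [map_pow, map_pow, e1, e2]
        linear_combination (-x ^ 3 * y ^ 3 * ω ^ 3) * hω3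
    right
    apply mul_right_cancel₀ (pow_ne_zero k (pow_ne_zero 3 hx))
    nth_rewrite 1 [hxy]
    rw [mul_assoc, ← mul_pow, ← mul_pow, k2, one_mul]

theorem polEquiv_cubeCubic_of_pow_eq (T : CubicCase q σ ω k n) (S : QuadExt F q σ) {r s : F}
    (hr : ∀ t, t ^ 3 ≠ r) (hs : ∀ t, t ^ 3 ≠ s) (h : s ^ k = r ^ k) :
    PolEquiv q (cubeCubic ω r) (cubeCubic ω s) := by
  have hr0 : r ≠ 0 := fun h => hr 0 (by rw [h]; simp)
  have hr1 : 1 - r ≠ 0 := fun h => hr 1 (by linear_combination h)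
  have hs1 : s ≠ 1 := fun h => hs 1 (by rw [h, one_pow])
  have hω3 := T.pow_three
  have hd : ω - 1 ≠ 0 := sub_ne_zero.2 (T.ne_one S)
  obtain ⟨t, ht, htk⟩ := T.exists_cube_root (s := s / r)
    (by rw [div_pow, h, div_self (pow_ne_zero k hr0)])
  have hst : s = t ^ 3 * r := by rw [ht, div_mul_cancel₀ _ hr0]
  have ht0 : t ≠ 0 := by
    rintro rfl
    exact hs 0 (by rw [hst]; ring)
  have key : ∀ e : F, e ≠ 0 →
      ((σ ω = ω ∧ σ e = t * e ∧ σ (t * e) = e) ∨ (σ ω = ω ^ 2 ∧ σ e = e ∧ σ (t * e) = t * e)) →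
      PolEquiv q (cubeCubic ω r) (cubeCubic ω s) := by
    intro e he hcase
    obtain ⟨i, hi⟩ : ∃ i, i = (ω - 1)⁻¹ := ⟨_, rfl⟩
    have hi1 : (ω - 1) * i = 1 := by rw [hi, mul_inv_cancel₀ hd]
    have hu : σ (i * (ω * (t * e) - e)) = i * (ω * e - t * e) := by
      have : σ i = (σ ω - 1)⁻¹ := by rw [hi, map_inv₀, map_sub, map_one]
      rcases hcase with ⟨h1, h2, h3⟩ | ⟨h1, h2, h3⟩
      · rw [map_mul, map_sub, map_mul, this, h1, h2, h3, hi]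
      · have h4 : ω ^ 2 - 1 = -ω ^ 2 * (ω - 1) := by linear_combination hω3
        have h5 : (-ω ^ 2 * (ω - 1))⁻¹ = -ω * i := by
          rw [hi, mul_inv]
          congr 1
          exact inv_eq_of_mul_eq_one_right (by linear_combination hω3)
        rw [map_mul, map_sub, map_mul, this, h1, h2, h3, h4, h5]
        linear_combination -i * t * e * hω3
    have hv : σ (i * (ω ^ 2 * (t * e - e))) = i * (ω ^ 2 * (e - t * e)) := by
      have : σ i = (σ ω - 1)⁻¹ := by rw [hi, map_inv₀, map_sub, map_one]
      rcases hcase with ⟨h1, h2, h3⟩ | ⟨h1, h2, h3⟩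
      · rw [map_mul, map_mul, map_pow, map_sub, this, h1, h2, h3, hi]
      · have h4 : ω ^ 2 - 1 = -ω ^ 2 * (ω - 1) := by linear_combination hω3
        have h5 : (-ω ^ 2 * (ω - 1))⁻¹ = -ω * i := by
          rw [hi, mul_inv]
          congr 1
          exact inv_eq_of_mul_eq_one_right (by linear_combination hω3)
        rw [map_mul, map_mul, map_pow, map_sub, this, h1, h2, h3, h4, h5]
        linear_combination i * (e - t * e) * ω ^ 2 * hω3
    refine S.polEquiv_cubeCubic_of_forms T.root (inv_ne_zero hr1) he (mul_ne_zero ht0 he)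
      (u := i * (ω * (t * e) - e)) (v := i * (ω ^ 2 * (t * e - e))) ?_ ?_ ?_ ?_ hs1 ?_
    · rw [hu, hv]
      linear_combination e * hi1 - i * (e - t * e) * hω3
    · linear_combination -ω * e * hi1
    · rw [hu, hv]
      linear_combination t * e * hi1 - i * ω * (e - t * e) * hω3
    · linear_combination -ω ^ 2 * t * e * hi1
    · rw [hst]; ring
  rcases (T.pow_eq_one_iff S ht0).1 htk with ⟨h1, h2⟩ | ⟨h1, h2⟩
  · obtain ⟨e, he, hσe⟩ := S.exists_map_eq_mul h2
    refine key e he (Or.inl ⟨h1, hσe, ?_⟩)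
    rw [← hσe, S.invol]
  · exact key 1 one_ne_zero (Or.inr ⟨h1, map_one σ, by rw [mul_one, h2]⟩)

theorem polEquiv_cubeCubic_inv (T : CubicCase q σ ω k n) (S : QuadExt F q σ) {r : F}
    (hr : ∀ t, t ^ 3 ≠ r) : PolEquiv q (cubeCubic ω r) (cubeCubic ω r⁻¹) := by
  have hr0 : r ≠ 0 := fun h => hr 0 (by rw [h]; simp)
  have hr1 : 1 - r ≠ 0 := fun h => hr 1 (by linear_combination h)
  have hri : r⁻¹ ≠ 1 := fun h => hr 1 (by rw [one_pow, ← inv_inv r, h, inv_one])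
  have hω3 := T.pow_three
  rw [cubeCubic, add_comm]
  refine S.polEquiv_cubeCubic_of_forms T.root (u := 0) (v := 1)
    (neg_ne_zero.2 (mul_ne_zero hr0 (inv_ne_zero hr1)))
    (neg_ne_zero.2 (pow_ne_zero 2 T.ne_zero)) (neg_ne_zero.2 T.ne_zero) ?_ ?_ ?_ ?_ hri ?_
  · simp
  · simp; linear_combination -hω3
  · simp
  · simp; linear_combination -hω3
  · field_simp
    linear_combination ω ^ 3 * hω3

theorem polEquiv_cubeCubic_iff (T : CubicCase q σ ω k n) (S : QuadExt F q σ) {r s : F}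
    (hr : ∀ t, t ^ 3 ≠ r) (hs : ∀ t, t ^ 3 ≠ s) :
    PolEquiv q (cubeCubic ω r) (cubeCubic ω s) ↔ s ^ k = r ^ k ∨ s ^ k * r ^ k = 1 := by
  constructor
  · intro h
    obtain ⟨lam, u, v, hlam, huv, R, hR, h⟩ := S.polEquiv_iff.1 h
    rcases hR with rfl | rfl
    · exact T.pow_eq_of_moebius3 S hr hs hlam huv h
    · obtain ⟨r', hr', hmap, hk⟩ := T.exists_map_cubeCubic S hr
      rw [hmap] at h
      rw [← hk]
      exact T.pow_eq_of_moebius3 S hr' hs hlam huv h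
  · rintro (h | h)
    · exact T.polEquiv_cubeCubic_of_pow_eq S hr hs h
    · have hri : ∀ t, t ^ 3 ≠ r⁻¹ := fun t h => hr t⁻¹ (by rw [inv_pow, h, inv_inv])
      refine S.polEquiv_trans (natDegree_cubeCubic_le ω r) (T.polEquiv_cubeCubic_inv S hr)
        (T.polEquiv_cubeCubic_of_pow_eq S hri hs ?_)
      rw [inv_pow]
      exact eq_inv_of_mul_eq_one_left h

end CubicCase

theorem card_filter_not_three_dvd (m : ℕ) :
    ((Finset.range (3 * m)).filter (fun j => ¬ 3 ∣ j)).card = 2 * m := by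
  induction m with
  | zero => simp
  | succ m ih =>
    have h0 : 3 ∣ 3 * m := ⟨m, rfl⟩
    have h1 : ¬ 3 ∣ 3 * m + 1 := by omega
    have h2 : ¬ 3 ∣ 3 * m + 2 := by omega
    rw [show 3 * (m + 1) = 3 * m + 1 + 1 + 1 by ring, Finset.range_add_one, Finset.range_add_one,
      Finset.range_add_one, Finset.filter_insert, Finset.filter_insert, Finset.filter_insert,
      if_pos h2, if_pos h1, if_neg (not_not.2 h0), Finset.card_insert_of_notMem (by simp),
      Finset.card_insert_of_notMem (by simp), ih]
    ring

theorem IsPrimitiveRoot.pow_eq_pow_iff {F : Type*} [Field F] {γ : F} {N : ℕ}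
    (h : IsPrimitiveRoot γ N) (hγ : γ ≠ 0) (a b : ℕ) :
    γ ^ a = γ ^ b ↔ (N : ℤ) ∣ (a : ℤ) - b := by
  rw [← h.zpow_eq_one_iff_dvd, zpow_sub₀ hγ, zpow_natCast, zpow_natCast,
    div_eq_one_iff_eq (pow_ne_zero b hγ)]

namespace CubicCase

variable {F : Type*} [Field F] [Fintype F] {q : ℕ} {σ : F →+* F} {ω : F} {k n : ℕ}

theorem three_mul_ncard_classes (T : CubicCase q σ ω k n) (S : QuadExt F q σ) :
    3 * Set.ncard {A : Set F[X] | ∃ P, Good q P ∧ A = {Q | Good q Q ∧ PolEquiv q P Q}} = n := by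
  obtain ⟨m, rfl⟩ := T.dvd
  obtain ⟨γ, hγ⟩ := S.exists_primitiveRoot
  have hN : 0 < q ^ 2 - 1 := by
    have := Nat.pow_le_pow_left S.five_le 2
    omega
  have hγ0 : γ ≠ 0 := hγ.ne_zero hN.ne'
  have hδ : IsPrimitiveRoot (γ ^ k) (6 * m) := hγ.pow hN T.mul_eq
  have hm : 0 < m := by
    rcases Nat.eq_zero_or_pos m with rfl | h
    · have := T.mul_eq
      omega
    · exact h
  have exists_pow : ∀ t : F, t ≠ 0 → ∃ i, γ ^ i = t := by
    intro t ht
    have : NeZero (q ^ 2 - 1) := ⟨hN.ne'⟩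
    obtain ⟨i, -, hi⟩ := hγ.eq_pow_of_pow_eq_one
      (by rw [← S.card]; exact FiniteField.pow_card_sub_one_eq_one t ht)
    exact ⟨i, hi⟩
  have noncube : ∀ j : ℕ, ¬ 3 ∣ j ↔ ∀ t, t ^ 3 ≠ γ ^ j := by
    intro j
    rw [← not_exists, not_iff_not]
    constructor
    · rintro ⟨i, rfl⟩
      exact ⟨γ ^ i, by rw [← pow_mul, mul_comm]⟩
    · rintro ⟨t, ht⟩
      obtain ⟨i, rfl⟩ := exists_pow t (by
        rintro rfl
        exact pow_ne_zero j hγ0 (by rw [← ht]; simp))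
      rw [← pow_mul, hγ.pow_eq_pow_iff hγ0] at ht
      have h3 : (3 : ℤ) ∣ ((q ^ 2 - 1 : ℕ) : ℤ) := by
        rw [T.mul_eq]
        exact ⟨k * (2 * m), by push_cast; ring⟩
      have := h3.trans ht
      omega
  have equiv_iff : ∀ i j : ℕ, ¬ 3 ∣ i → ¬ 3 ∣ j →
      (PolEquiv q (cubeCubic ω (γ ^ i)) (cubeCubic ω (γ ^ j)) ↔
        (6 * m : ℤ) ∣ j - i ∨ (6 * m : ℤ) ∣ j + i) := by
    intro i j hi hj
    rw [T.polEquiv_cubeCubic_iff S ((noncube i).1 hi) ((noncube j).1 hj), ← pow_mul, ← pow_mul,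
      mul_comm j, mul_comm i, pow_mul, pow_mul, hδ.pow_eq_pow_iff (pow_ne_zero k hγ0), ← pow_add,
      hδ.pow_eq_one_iff_dvd, ← Int.natCast_dvd_natCast]
    push_cast
    rfl
  have class_eq : ∀ {P Q : F[X]}, Good q P → Q.natDegree ≤ 3 → PolEquiv q P Q →
      {R | Good q R ∧ PolEquiv q P R} = {R | Good q R ∧ PolEquiv q Q R} := by
    intro P Q hP hQ h
    ext R
    exact and_congr_right fun _ =>
      ⟨S.polEquiv_trans hQ (S.polEquiv_symm hP.2.1.le h), S.polEquiv_trans hP.2.1.le h⟩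
  have good : ∀ j : ℕ, ¬ 3 ∣ j → Good q (cubeCubic ω (γ ^ j)) := fun j hj =>
    T.good_cubeCubic S ((noncube j).1 hj)
  let f : ℕ → Set F[X] := fun j => {Q | Good q Q ∧ PolEquiv q (cubeCubic ω (γ ^ j)) Q}
  have himage : {A : Set F[X] | ∃ P, Good q P ∧ A = {Q | Good q Q ∧ PolEquiv q P Q}} =
      f '' ((Finset.range (3 * m)).filter (fun j => ¬ 3 ∣ j) : Finset ℕ) := by
    ext A
    simp only [Set.mem_ofPred_eq, Set.mem_image, Finset.mem_coe, Finset.mem_filter,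
      Finset.mem_range]
    constructor
    · rintro ⟨P, hP, rfl⟩
      obtain ⟨r, hr, hPr⟩ := T.exists_polEquiv_cubeCubic S hP
      obtain ⟨i, rfl⟩ := exists_pow r (fun h => hr 0 (by rw [h]; simp))
      have hi := (noncube i).2 hr
      obtain ⟨j, hj, hj3, hij⟩ : ∃ j, j < 3 * m ∧ ¬ 3 ∣ j ∧
          ((6 * m : ℤ) ∣ j - i ∨ (6 * m : ℤ) ∣ j + i) := by
        have hdiv := Nat.div_add_mod i (6 * m)
        have hlt := Nat.mod_lt i (show 6 * m > 0 by omega)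
        have h3 : 3 ∣ 6 * m * (i / (6 * m)) := ⟨2 * m * (i / (6 * m)), by ring⟩
        have hz : (6 * m : ℤ) * ((i / (6 * m) : ℕ) : ℤ) + ((i % (6 * m) : ℕ) : ℤ) = i := by
          exact_mod_cast hdiv
        by_cases h : i % (6 * m) < 3 * m
        · refine ⟨i % (6 * m), h, by omega, Or.inl ⟨-((i / (6 * m) : ℕ) : ℤ), ?_⟩⟩
          linear_combination hz
        · refine ⟨6 * m - i % (6 * m), by omega, by omega,
            Or.inr ⟨((i / (6 * m) : ℕ) : ℤ) + 1, ?_⟩⟩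
          rw [Nat.cast_sub hlt.le]
          push_cast at hz ⊢
          linear_combination -hz
      refine ⟨j, ⟨hj, hj3⟩, (class_eq hP (natDegree_cubeCubic_le _ _)
        (S.polEquiv_trans hP.2.1.le hPr
        ((equiv_iff i j hi hj3).2 hij))).symm⟩
    · rintro ⟨j, ⟨-, hj⟩, rfl⟩
      exact ⟨_, good j hj, rfl⟩
  have hinj : Set.InjOn f ((Finset.range (3 * m)).filter (fun j => ¬ 3 ∣ j) : Finset ℕ) := by
    intro i hi j hj hij
    simp only [Finset.mem_coe, Finset.mem_filter, Finset.mem_range] at hi hj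
    have hmem : cubeCubic ω (γ ^ j) ∈ f j :=
      ⟨good j hj.2, (equiv_iff j j hj.2 hj.2).2 (Or.inl (by simp))⟩
    rw [← hij] at hmem
    rcases (equiv_iff i j hi.2 hj.2).1 hmem.2 with h | h
    · have := Int.eq_zero_of_abs_lt_dvd h (by rw [abs_lt]; omega)
      omega
    · have := Int.eq_zero_of_abs_lt_dvd h (by rw [abs_lt]; omega)
      omega
  rw [himage, hinj.ncard_image, Set.ncard_coe_finset, card_filter_not_three_dvd]
  ring

end CubicCase

theorem exists_quadExt {p n q : ℕ} (hp : p.Prime) (hp3 : 3 < p) (hn : n ≠ 0) (hq : q = p ^ n)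
    (F : Type*) [Field F] [Fintype F] (hF : Fintype.card F = q ^ 2) :
    ∃ σ : F →+* F, QuadExt F q σ := by
  have : Fact p.Prime := ⟨hp⟩
  have : CharP F p := charP_of_card_eq_prime_pow (f := n * 2) (by rw [hF, hq, pow_mul])
  have two : ((2 : ℕ) : F) ≠ 0 := by
    rw [Ne, CharP.cast_eq_zero_iff F p]
    exact fun h => by have := Nat.le_of_dvd two_pos h; omega
  have three : ((3 : ℕ) : F) ≠ 0 := by
    rw [Ne, CharP.cast_eq_zero_iff F p]
    exact fun h => by have := Nat.le_of_dvd three_pos h; omega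
  have h5 : 5 ≤ p := by
    rcases hp.eq_two_or_odd with h | h <;> omega
  refine ⟨iterateFrobenius F p n, ?_, ?_, hF, ?_, ?_, ?_, ?_, ?_⟩
  · intro x; rw [iterateFrobenius_def, hq]
  · intro x
    rw [iterateFrobenius_def, iterateFrobenius_def, ← hq, ← pow_mul, ← sq, ← hF,
      FiniteField.pow_card]
  · rw [hq]; exact (hp.odd_of_ne_two (by omega)).pow
  · rw [hq]; exact h5.trans (Nat.le_self_pow hn p)
  · exact_mod_cast two
  · exact_mod_cast three
  · rw [hq, Nat.cast_pow, CharP.cast_eq_zero, zero_pow hn]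

theorem QuadExt.exists_cubicCase {F : Type*} [Field F] [Fintype F] {q : ℕ} {σ : F →+* F}
    (S : QuadExt F q σ) :
    (q % 3 = 1 → ∃ ω, CubicCase q σ ω (q + 1) (q - 1)) ∧
    (q % 3 = 2 → ∃ ω, CubicCase q σ ω (q - 1) (q + 1)) := by
  have h5 := S.five_le
  have hmul := S.sq_sub_one
  obtain ⟨j, hj⟩ := S.odd
  have hω : 3 ∣ q ^ 2 - 1 → ∃ ω : F, ω ^ 3 = 1 ∧ ω ^ 2 + ω + 1 = 0 := by
    rintro ⟨m, hm⟩
    obtain ⟨γ, hγ⟩ := S.exists_primitiveRoot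
    have h0 : 0 < q ^ 2 - 1 := by
      have := Nat.pow_le_pow_left h5 2
      omega
    have h := hγ.pow h0 (hm.trans (mul_comm _ _))
    refine ⟨γ ^ m, h.pow_eq_one, ?_⟩
    apply mul_left_cancel₀ (sub_ne_zero.2 (h.ne_one (by norm_num)))
    linear_combination h.pow_eq_one
  constructor
  · intro h
    obtain ⟨m, hm⟩ : 3 ∣ q - 1 := by omega
    obtain ⟨ω, h3, hω⟩ := hω ⟨m * (q + 1), by rw [hmul, hm]; ring⟩
    refine ⟨ω, hω, by rw [hmul, mul_comm], by omega, ⟨(q + 2) / 3, 1, by omega⟩, Or.inl ⟨?_, rfl⟩⟩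
    rw [S.pow, show q = 3 * m + 1 by omega, pow_add, pow_mul, h3, one_pow, one_mul, pow_one]
  · intro h
    obtain ⟨m, hm⟩ : 3 ∣ q + 1 := by omega
    obtain ⟨ω, h3, hω⟩ := hω ⟨(q - 1) * m, by rw [hmul, hm]; ring⟩
    refine ⟨ω, hω, hmul, by omega, ⟨(2 * q - 1) / 3, 2, by omega⟩, Or.inr ⟨?_, by omega⟩⟩
    rw [S.pow, show q = 3 * (m - 1) + 2 by omega, pow_add, pow_mul, h3, one_pow, one_mul]

/-- Corollary: every monic irreducible cubic over `𝔽_{q²}` satisfying Condition (1) is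
equivalent to some `P_{δ,1}(x) = x³ − δx² − (δ+3)x − 1`; and the number of equivalence
classes is `(q−1)/3` if `q ≡ 1 (mod 3)` and `(q+1)/3` if `q ≡ 2 (mod 3)`. -/
theorem statement19 (p n q : ℕ) (hp : p.Prime) (hp3 : 3 < p) (hn : n ≠ 0) (hq : q = p ^ n)
    (F : Type*) [Field F] [Fintype F] (hF : Fintype.card F = q ^ 2) :
    (∀ P : Polynomial F, Good q P →
      ∃ δ : F, PolEquiv q P (X ^ 3 - C δ * X ^ 2 - C (δ + 3) * X - 1)) ∧
    (q % 3 = 1 →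
      3 * Set.ncard {S : Set (Polynomial F) |
          ∃ P : Polynomial F, Good q P ∧ S = {Q | Good q Q ∧ PolEquiv q P Q}} = q - 1) ∧
    (q % 3 = 2 →
      3 * Set.ncard {S : Set (Polynomial F) |
          ∃ P : Polynomial F, Good q P ∧ S = {Q | Good q Q ∧ PolEquiv q P Q}} = q + 1) := by
  obtain ⟨σ, S⟩ := exists_quadExt hp hp3 hn hq F hF
  obtain ⟨h1, h2⟩ := S.exists_cubicCase
  refine ⟨?_, fun h => ?_, fun h => ?_⟩
  · intro P hP
    have key : ∀ {ω k n}, CubicCase q σ ω k n →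
        ∃ δ : F, PolEquiv q P (X ^ 3 - C δ * X ^ 2 - C (δ + 3) * X - 1) := by
      intro ω k n T
      obtain ⟨r, hr, hPr⟩ := T.exists_polEquiv_cubeCubic S hP
      obtain ⟨δ, hδ⟩ := cubeCubic_eq T.root (r := r) (fun h => hr 1 (by rw [h, one_pow]))
      exact ⟨δ, hδ ▸ hPr⟩
    have h3 : q % 3 ≠ 0 := by
      intro h
      have := (Nat.prime_dvd_prime_iff_eq Nat.prime_three hp).1
        (Nat.prime_three.dvd_of_dvd_pow (hq ▸ Nat.dvd_of_mod_eq_zero h))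
      omega
    rcases show q % 3 = 1 ∨ q % 3 = 2 by omega with h | h
    · obtain ⟨ω, T⟩ := h1 h
      exact key T
    · obtain ⟨ω, T⟩ := h2 h
      exact key T
  · obtain ⟨ω, T⟩ := h1 h
    exact T.three_mul_ncard_classes S
  · obtain ⟨ω, T⟩ := h2 h
    exact T.three_mul_ncard_classes S
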